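/- arXiv:1605.06361 — 3 statements merged into one kernel-verified Lean document; each statement's English description precedes it below -/
import Mathlib

section
/- For every δ with 0 < δ < 1/2 there exist infinitely many integers r with the following property: there exist at least exp(r^{1/2−δ}) pairwise non-isomorphic minimal intersecting r-Ryser hypergraphs, i.e., r-partite r-uniform intersecting hypergraphs H with τ(H) = r−1 such that for every edge e ∈ H the hypergraph H − e has cover number r−2. -/
open Finset

noncomputable section
open scoped Classical

/-- A set of vertices `C` covers the hypergraph `H` if it meets every edge. -/
def IsCover {V : Type*} (C : Set V) (H : Set (Finset V)) : Prop :=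
  ∀ e ∈ H, ∃ v ∈ C, v ∈ e

/-- The cover number `τ(H)`: the minimum cardinality of a cover of `H`. -/
noncomputable def coverNumber {V : Type*} (H : Set (Finset V)) : ℕ :=
  sInf {n | ∃ C : Finset V, IsCover (↑C) H ∧ C.card = n}

/-- The matching number `ν(H)`: the maximum size of a set of pairwise disjoint edges. -/
noncomputable def matchingNumber {V : Type*} (H : Set (Finset V)) : ℕ :=
  sSup {n | ∃ M : Finset (Finset V), ↑M ⊆ H ∧
    (M : Set (Finset V)).Pairwise (fun e₁ e₂ => Disjoint e₁ e₂) ∧ M.card = n}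

/-- A hypergraph is intersecting if any two edges share a vertex. -/
def Intersecting {V : Type*} (H : Set (Finset V)) : Prop :=
  ∀ e₁ ∈ H, ∀ e₂ ∈ H, ∃ v, v ∈ e₁ ∧ v ∈ e₂

/-- A hypergraph is `r`-uniform if every edge has exactly `r` vertices. -/
def Uniform {V : Type*} (H : Set (Finset V)) (r : ℕ) : Prop :=
  ∀ e ∈ H, e.card = r

/-- `H` is `r`-partite with the given sides: the sides partition the vertex set and
every edge has at most one vertex in each side. -/
def Partite {V : Type*} {r : ℕ} (H : Set (Finset V)) (sides : Fin r → Set V) : Prop :=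
  (∀ v : V, ∃! i, v ∈ sides i) ∧
  ∀ e ∈ H, ∀ i : Fin r, ∀ x ∈ e, ∀ y ∈ e, x ∈ sides i → y ∈ sides i → x = y

/-- Two hypergraphs are isomorphic if a bijection of the vertex sets carries the
edge set of one onto the edge set of the other. -/
def Isomorphic {V W : Type*} (H₁ : Set (Finset V)) (H₂ : Set (Finset W)) : Prop :=
  ∃ φ : V ≃ W, ∀ e : Finset V, e ∈ H₁ ↔ e.image φ ∈ H₂

/-- The edge `Ê = E ∪ {v_i}`, where the new vertex `v_i` is encoded as `Sum.inr i`. -/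
def hatE {V : Type*} {r : ℕ} (E : Finset V) (i : Fin r) : Finset (V ⊕ Fin r) :=
  insert (Sum.inr i) (E.image Sum.inl)

/-- The construction `H(T, S, F_1, …, F_r)`, with new vertices `v_i = Sum.inr i`. -/
def constructionH {V : Type*} {r : ℕ} (T : Set (Finset V)) (S : Finset V)
    (s : Fin r → V) (F : Fin r → Finset V) : Set (Finset (V ⊕ Fin r)) :=
  {Eh | ∃ E ∈ T, E ≠ S ∧ ∃ i : Fin r, s i ∈ E ∧ Eh = hatE E i} ∪
  {Eh | ∃ i : Fin r, Eh = (F i).image Sum.inl} ∪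
  {Eh | ∃ i : Fin r, Eh = hatE ((F i).erase (s i)) i}

/-- The hypergraph `S(T, S, F_1, …, F_r) = E2 ∪ E3`. -/
def constructionS {V : Type*} {r : ℕ}
    (s : Fin r → V) (F : Fin r → Finset V) : Set (Finset (V ⊕ Fin r)) :=
  {Eh | ∃ i : Fin r, Eh = (F i).image Sum.inl} ∪
  {Eh | ∃ i : Fin r, Eh = hatE ((F i).erase (s i)) i}

/-- The sides of the construction: the old sides (lifted), plus the new side `{v_1, …, v_r}`. -/
def extSides {V : Type*} {r : ℕ} (sides : Fin r → Set V) : Fin (r + 1) → Set (V ⊕ Fin r) :=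
  Fin.lastCases (Set.range Sum.inr) (fun i => Sum.inl '' sides i)

open Configuration

/-- The points of the line `ℓ` other than `w`, as a finset of the vertex type `{p // p ≠ w}`. -/
noncomputable def linePoints {P L : Type*} [Membership P L] [Fintype P] (w : P) (ℓ : L) :
    Finset {p : P // p ≠ w} :=
  Finset.univ.filter (fun p : {p : P // p ≠ w} => (p : P) ∈ ℓ)

/-- The truncated projective plane at the point `w`: the edges are the point sets of
the lines not passing through `w`, on the vertex set of points other than `w`. -/
noncomputable def truncatedPP (P : Type*) (L : Type*) [Membership P L] [Fintype P] (w : P) :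
    Set (Finset {p : P // p ≠ w}) :=
  {E | ∃ ℓ : L, w ∉ ℓ ∧ E = linePoints w ℓ}

/-- The sides of the truncated projective plane, given an enumeration `m` of
the lines through `w`. -/
def ppSide {P L : Type*} [Membership P L] {r : ℕ} (w : P) (m : Fin r → L) (i : Fin r) :
    Set {p : P // p ≠ w} :=
  {p : {p : P // p ≠ w} | (p : P) ∈ m i}

/-- `m` enumerates the lines through `w`. -/
def EnumeratesLinesThrough {P L : Type*} [Membership P L] {r : ℕ} (w : P) (m : Fin r → L) : Prop :=
  Function.Injective m ∧ (∀ i, w ∈ m i) ∧ ∀ ℓ : L, w ∈ ℓ → ∃ i, m i = ℓ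

namespace Ryser

lemma coverNumber_eq {V : Type*} {H : Set (Finset V)} {n : ℕ}
    (hle : ∃ C : Finset V, IsCover (↑C) H ∧ C.card ≤ n)
    (hge : ∀ C : Finset V, IsCover (↑C) H → n ≤ C.card) : coverNumber H = n := by
  obtain ⟨C, hC, hCn⟩ := hle
  have hcard : C.card = n := le_antisymm hCn (hge C hC)
  refine le_antisymm (Nat.sInf_le ⟨C, hC, hcard⟩) (le_csInf ⟨n, C, hC, hcard⟩ ?_)
  rintro m ⟨D, hD, rfl⟩
  exact hge D hD

/-- A finite hypergraph without covers of size at most `q` contains one that is critical for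
this property. -/
lemma exists_critical {V : Type*} {H : Set (Finset V)} (hfin : H.Finite) {q : ℕ}
    (h : ∀ C : Finset V, IsCover (↑C) H → q < C.card) :
    ∃ H' ⊆ H, (∀ C : Finset V, IsCover (↑C) H' → q < C.card) ∧
      ∀ e ∈ H', ∃ C : Finset V, IsCover (↑C) (H' \ {e}) ∧ C.card ≤ q := by
  have hf : {K : Set (Finset V) | K ⊆ H ∧
      ∀ C : Finset V, IsCover (↑C) K → q < C.card}.Finite :=
    hfin.finite_subsets.subset fun K hK => hK.1
  obtain ⟨K, hK⟩ := hf.exists_minimal ⟨H, Set.Subset.rfl, h⟩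
  refine ⟨K, hK.prop.1, hK.prop.2, fun e he => ?_⟩
  by_contra! hcon
  have := hK.le_of_le (y := K \ {e}) ⟨Set.sdiff_subset.trans hK.prop.1, hcon⟩ Set.sdiff_subset
  exact (this he).2 rfl

lemma exists_cover_insert {V : Type*} {H : Set (Finset V)} {e : Finset V} (he : e.Nonempty)
    {C : Finset V} (hC : IsCover (↑C) (H \ {e})) :
    ∃ C' : Finset V, IsCover (↑C') H ∧ C'.card ≤ C.card + 1 := by
  obtain ⟨v, hv⟩ := he
  refine ⟨insert v C, fun f hf => ?_, card_insert_le v C⟩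
  by_cases hfe : f = e
  · exact ⟨v, by simp, hfe ▸ hv⟩
  · obtain ⟨u, hu, huf⟩ := hC f ⟨hf, hfe⟩
    exact ⟨u, by simpa using Or.inr hu, huf⟩

lemma coverNumber_of_critical {V : Type*} {H : Set (Finset V)} {q : ℕ}
    (hne : ∀ e ∈ H, e.Nonempty) (h : ∀ C : Finset V, IsCover (↑C) H → q < C.card)
    (hcrit : ∀ e ∈ H, ∃ C : Finset V, IsCover (↑C) (H \ {e}) ∧ C.card ≤ q) :
    coverNumber H = q + 1 ∧ ∀ e ∈ H, coverNumber (H \ {e}) = q := by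
  constructor
  · obtain ⟨e, he⟩ : H.Nonempty := by
      by_contra hH
      rw [Set.not_nonempty_iff_eq_empty] at hH
      simpa using h ∅ (by simp [hH, IsCover])
    obtain ⟨C, hC, hCq⟩ := hcrit e he
    obtain ⟨C', hC', hcard⟩ := exists_cover_insert (hne e he) hC
    exact coverNumber_eq ⟨C', hC', by omega⟩ h
  · intro e he
    refine coverNumber_eq (hcrit e he) fun C hC => ?_
    obtain ⟨C', hC', hcard⟩ := exists_cover_insert (hne e he) hC
    have := h C' hC'
    omega

/-- The edges that share at least three vertices with another edge. -/
def core {V : Type*} (H : Set (Finset V)) : Set (Finset V) :=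
  {e | e ∈ H ∧ ∃ f ∈ H, f ≠ e ∧ 3 ≤ (e ∩ f).card}

/-- The degree of a vertex in the core. -/
def coreDegree {V : Type*} (H : Set (Finset V)) (x : V) : ℕ :=
  {e | e ∈ core H ∧ x ∈ e}.ncard

lemma mem_core_image {V W : Type*} {H₁ : Set (Finset V)} {H₂ : Set (Finset W)} (φ : V ≃ W)
    (h : ∀ e : Finset V, e ∈ H₁ ↔ e.image φ ∈ H₂) (e : Finset V) :
    e ∈ core H₁ ↔ e.image φ ∈ core H₂ := by
  have himg : Function.Injective (fun e : Finset V => e.image φ) :=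
    Finset.image_injective φ.injective
  have hinter (e f : Finset V) : (e.image φ ∩ f.image φ).card = (e ∩ f).card := by
    rw [← image_inter _ _ φ.injective, card_image_of_injective _ φ.injective]
  constructor
  · rintro ⟨he, f, hf, hfe, hc⟩
    exact ⟨(h e).1 he, f.image φ, (h f).1 hf, himg.ne hfe, by rwa [hinter]⟩
  · rintro ⟨he, f, hf, hfe, hc⟩
    obtain ⟨f, rfl⟩ : ∃ f' : Finset V, f'.image φ = f := ⟨f.image φ.symm, by simp [image_image]⟩
    exact ⟨(h e).2 he, f, (h f).2 hf, fun hh => hfe (by rw [hh]), by rwa [hinter] at hc⟩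

lemma Isomorphic.exists_coreDegree_eq_iff {V W : Type*} {H₁ : Set (Finset V)}
    {H₂ : Set (Finset W)} (h : Isomorphic H₁ H₂) (n : ℕ) :
    (∃ x, coreDegree H₁ x = n) ↔ ∃ x, coreDegree H₂ x = n := by
  obtain ⟨φ, hφ⟩ := h
  have hdeg (x : V) : coreDegree H₂ (φ x) = coreDegree H₁ x := by
    have : {e | e ∈ core H₂ ∧ φ x ∈ e} =
        (fun e : Finset V => e.image φ) '' {e | e ∈ core H₁ ∧ x ∈ e} := by
      ext e
      constructor
      · rintro ⟨he, hx⟩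
        obtain ⟨e, rfl⟩ : ∃ e' : Finset V, e'.image φ = e :=
          ⟨e.image φ.symm, by simp [image_image]⟩
        exact ⟨e, ⟨(mem_core_image φ hφ e).2 he, by simpa using hx⟩, rfl⟩
      · rintro ⟨e, ⟨he, hx⟩, rfl⟩
        exact ⟨(mem_core_image φ hφ e).1 he, mem_image_of_mem φ hx⟩
    rw [coreDegree, this, Set.ncard_image_of_injective _ (Finset.image_injective φ.injective)]
    rfl
  constructor
  · rintro ⟨x, rfl⟩
    exact ⟨φ x, hdeg x⟩
  · rintro ⟨x, rfl⟩
    exact ⟨φ.symm x, by rw [← hdeg]; simp⟩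

section Transversal

variable {F : Type*} [Fintype F]

/-- Vertices: the pairs (column, value or padding), and a last column carrying, for every `i`, a
new vertex `(i, true)` and a padding vertex `(i, false)`. -/
abbrev Vertex (F : Type*) : Type _ := (Option F × Option F) ⊕ (Option F × Bool)

/-- The transversal with entries `h` in the columns and `t` in the last column. -/
def transversal (h : Option F → Option F) (t : Option F × Bool) : Finset (Vertex F) :=
  insert (Sum.inr t) (univ.image fun j => Sum.inl (j, h j))

lemma inl_mem_transversal {h : Option F → Option F} {t : Option F × Bool} {j : Option F}
    {o : Option F} : Sum.inl (j, o) ∈ transversal h t ↔ h j = o := by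
  simp [transversal]

lemma inr_mem_transversal {h : Option F → Option F} {t s : Option F × Bool} :
    Sum.inr s ∈ transversal h t ↔ s = t := by
  simp [transversal]

lemma card_transversal (h : Option F → Option F) (t : Option F × Bool) :
    (transversal h t).card = Fintype.card F + 2 := by
  rw [transversal, card_insert_of_notMem (by simp), card_image_of_injective _ ?_, card_univ,
    Fintype.card_option]
  intro i j hij
  exact congrArg Prod.fst (Sum.inl_injective hij)

/-- The column of a vertex, the last column being `none`. -/
def column : Vertex F → Option (Option F)
  | Sum.inl (j, _) => some j
  | Sum.inr _ => none

lemma eq_of_column_eq {h : Option F → Option F} {t : Option F × Bool} {x y : Vertex F}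
    (hx : x ∈ transversal h t) (hy : y ∈ transversal h t) (hxy : column x = column y) :
    x = y := by
  rcases x with ⟨j, o⟩ | s <;> rcases y with ⟨j', o'⟩ | s' <;>
    simp only [column, inl_mem_transversal, inr_mem_transversal, Option.some.injEq,
      reduceCtorEq] at hx hy hxy
  · subst hxy hx hy
    rfl
  · rw [hx, hy]

end Transversal

section Lines

variable {F : Type*} [Field F]

/-- The value in the column `j` of the line `y = g.1 * x + g.2`; the column `none` records the
slope. -/
def lineVal (g : F × F) : Option F → F
  | none => g.1
  | some x => g.1 * x + g.2

lemma lineVal_zero (j : Option F) : lineVal (0 : F × F) j = 0 := by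
  cases j <;> simp [lineVal]

lemma line_ext {g g' : F × F} {i j : Option F} (hij : i ≠ j)
    (hi : lineVal g i = lineVal g' i) (hj : lineVal g j = lineVal g' j) : g = g' := by
  obtain ⟨m, b⟩ := g
  obtain ⟨m', b'⟩ := g'
  rcases i with _ | x <;> rcases j with _ | y <;> simp only [lineVal] at hi hj
  · exact absurd rfl hij
  · subst hi
    simpa using hj
  · subst hj
    simpa using hi
  · have hxy : x - y ≠ 0 := sub_ne_zero.2 fun h => hij (by rw [h])
    have hm : m = m' := by
      refine mul_right_cancel₀ hxy ?_
      linear_combination hi - hj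
    subst hm
    simpa using hi

lemma eq_of_lineVal_eq_zero {g : F × F} (hg : g ≠ 0) {i j : Option F}
    (hi : lineVal g i = 0) (hj : lineVal g j = 0) : i = j := by
  by_contra hij
  exact hg (line_ext hij (by rw [hi, lineVal_zero]) (by rw [hj, lineVal_zero]))

lemma exists_lineVal_eq (g g' : F × F) : ∃ j, lineVal g j = lineVal g' j := by
  obtain ⟨m, b⟩ := g
  obtain ⟨m', b'⟩ := g'
  by_cases h : m = m'
  · exact ⟨none, h⟩
  · have h' : m - m' ≠ 0 := sub_ne_zero.2 h
    refine ⟨some ((b' - b) / (m - m')), ?_⟩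
    simp only [lineVal]
    field_simp
    ring

lemma exists_line {i j : Option F} (hij : i ≠ j) (a c : F) :
    ∃ g : F × F, lineVal g i = a ∧ lineVal g j = c := by
  rcases i with _ | x <;> rcases j with _ | y
  · exact absurd rfl hij
  · exact ⟨(a, c - a * y), rfl, by simp [lineVal]⟩
  · exact ⟨(c, a - c * x), by simp [lineVal], rfl⟩
  · have hxy : x - y ≠ 0 := sub_ne_zero.2 fun h => hij (by rw [h])
    refine ⟨((a - c) / (x - y), a - (a - c) / (x - y) * x), by simp [lineVal], ?_⟩
    simp only [lineVal]
    field_simp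
    ring

/-- Each `φ i` is a nonzero line that vanishes in the column `i`. -/
def VanishesOnDiagonal (φ : Option F → F × F) : Prop :=
  ∀ i, φ i ≠ 0 ∧ lineVal (φ i) i = 0

lemma VanishesOnDiagonal.eq_of_lineVal_eq_zero {φ : Option F → F × F}
    (hφ : VanishesOnDiagonal φ) {i j : Option F}
    (h : lineVal (φ i) j = 0) : j = i :=
  Ryser.eq_of_lineVal_eq_zero (hφ i).1 h (hφ i).2

/-- The lines with slopes `f`, together with a horizontal line. -/
def slopeLines (f : F → F) : Option F → F × F
  | none => (0, 1)
  | some i => (f i, -(f i * i))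

lemma vanishesOnDiagonal_slopeLines {f : F → F} (hf : ∀ i, f i ≠ 0) :
    VanishesOnDiagonal (slopeLines f) := by
  rintro (_ | i)
  · simp [slopeLines, lineVal]
  · simp [slopeLines, lineVal, hf i]

/-- The column of a vertex, or the point it represents if this point lies off the zero line. -/
def label : Vertex F → Option F ⊕ (Option F × F)
  | Sum.inl (i, none) => Sum.inl i
  | Sum.inl (i, some y) => if y = 0 then Sum.inl i else Sum.inr (i, y)
  | Sum.inr (i, _) => Sum.inl i

lemma label_eq_inl_iff {v : Vertex F} {i : Option F} :
    label v = Sum.inl i ↔ v = Sum.inl (i, none) ∨ v = Sum.inl (i, some 0) ∨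
      v = Sum.inr (i, true) ∨ v = Sum.inr (i, false) := by
  rcases v with ⟨j, _ | y⟩ | ⟨j, b⟩
  · simp [label]
  · by_cases hy : y = 0 <;> simp [label, hy]
  · cases b <;> simp [label]

lemma label_eq_inr_iff {v : Vertex F} {d : Option F × F} :
    label v = Sum.inr d ↔ d.2 ≠ 0 ∧ v = Sum.inl (d.1, some d.2) := by
  obtain ⟨i, z⟩ := d
  rcases v with ⟨j, _ | y⟩ | ⟨j, b⟩
  · simp [label]
  · by_cases hy : y = 0
    · simp only [label, hy, if_true, reduceCtorEq, Sum.inl.injEq, Prod.mk.injEq,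
        Option.some.injEq, false_iff]
      rintro ⟨h0, -, h⟩
      exact h0 h.symm
    · simp only [label, hy, if_false, Sum.inr.injEq, Prod.mk.injEq, Sum.inl.injEq,
        Option.some.injEq]
      constructor
      · rintro ⟨rfl, rfl⟩
        exact ⟨hy, rfl, rfl⟩
      · exact fun h => h.2
  · simp [label]

variable [Fintype F]

/-- The line `g`, extended by the new vertex `(i, true)`. -/
def lineEdge (g : F × F) (i : Option F) : Finset (Vertex F) :=
  transversal (fun j => some (lineVal g j)) (i, true)

/-- The line `g`, extended by the padding vertex `(i, false)`. -/
def plainEdge (g : F × F) (i : Option F) : Finset (Vertex F) :=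
  transversal (fun j => some (lineVal g j)) (i, false)

/-- The line `g` with its vertex in the column `i` replaced by padding, extended by the new vertex
`(i, true)`. -/
def cutEdge (g : F × F) (i : Option F) : Finset (Vertex F) :=
  transversal (Function.update (fun j => some (lineVal g j)) i none) (i, true)

/-- The hypergraph built from the truncated plane, the zero line and the lines `φ i`. -/
def family (φ : Option F → F × F) : Set (Finset (Vertex F)) :=
  {e | ∃ g i, g ≠ 0 ∧ lineVal g i = 0 ∧ (∀ k, g ≠ φ k) ∧ e = lineEdge g i} ∪
  {e | ∃ i, e = plainEdge (φ i) i} ∪ {e | ∃ i, e = cutEdge (φ i) i}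

variable {φ : Option F → F × F}

lemma mem_lineEdge {g : F × F} {i : Option F} {j : Option F} {o : Option F} :
    Sum.inl (j, o) ∈ lineEdge g i ↔ some (lineVal g j) = o := inl_mem_transversal

lemma mem_plainEdge {g : F × F} {i : Option F} {j : Option F} {o : Option F} :
    Sum.inl (j, o) ∈ plainEdge g i ↔ some (lineVal g j) = o := inl_mem_transversal

lemma some_mem_cutEdge {g : F × F} {i : Option F} {j : Option F} {y : F} :
    Sum.inl (j, some y) ∈ cutEdge g i ↔ j ≠ i ∧ lineVal g j = y := by
  rw [cutEdge, inl_mem_transversal]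
  by_cases h : j = i
  · subst h; simp
  · simp [h]

lemma none_mem_cutEdge {g : F × F} {i : Option F} {j : Option F} :
    Sum.inl (j, none) ∈ cutEdge g i ↔ j = i := by
  rw [cutEdge, inl_mem_transversal]
  by_cases h : j = i
  · subst h; simp
  · simp [h]

lemma inr_mem_lineEdge {g : F × F} {i : Option F} {s : Option F × Bool} :
    Sum.inr s ∈ lineEdge g i ↔ s = (i, true) := inr_mem_transversal

lemma inr_mem_plainEdge {g : F × F} {i : Option F} {s : Option F × Bool} :
    Sum.inr s ∈ plainEdge g i ↔ s = (i, false) := inr_mem_transversal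

lemma inr_mem_cutEdge {g : F × F} {i : Option F} {s : Option F × Bool} :
    Sum.inr s ∈ cutEdge g i ↔ s = (i, true) := inr_mem_transversal

lemma exists_transversal_of_mem_family {e : Finset (Vertex F)} (he : e ∈ family φ) :
    ∃ h t, e = transversal h t := by
  rcases he with (⟨g, i, -, -, -, rfl⟩ | ⟨i, rfl⟩) | ⟨i, rfl⟩ <;> exact ⟨_, _, rfl⟩

lemma uniform_family : Uniform (family φ) (Fintype.card F + 2) := by
  intro e he
  obtain ⟨h, t, rfl⟩ := exists_transversal_of_mem_family he
  exact card_transversal h t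

lemma exists_partite_family {H : Set (Finset (Vertex F))} (hH : H ⊆ family φ) :
    ∃ sides : Fin (Fintype.card F + 2) → Set (Vertex F), Partite H sides := by
  have hcard : Fintype.card (Option (Option F)) = Fintype.card F + 2 := by simp
  let ε := Fintype.equivFinOfCardEq hcard
  refine ⟨fun k => {v | ε (column v) = k}, fun v => ⟨_, rfl, fun k hk => hk.symm⟩, ?_⟩
  intro e he k x hx y hy hxk hyk
  obtain ⟨h, t, rfl⟩ := exists_transversal_of_mem_family (hH he)
  exact eq_of_column_eq hx hy (ε.injective (hxk.trans hyk.symm))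

lemma plainEdge_mem_family (i : Option F) : plainEdge (φ i) i ∈ family φ :=
  Or.inl (Or.inr ⟨i, rfl⟩)

lemma cutEdge_mem_family (i : Option F) : cutEdge (φ i) i ∈ family φ := Or.inr ⟨i, rfl⟩

lemma intersecting_family (hφ : VanishesOnDiagonal φ) : Intersecting (family φ) := by
  have key : ∀ g : F × F, ∀ i, (lineVal g i = 0 → g = φ i) →
      ∃ j, j ≠ i ∧ lineVal g j = lineVal (φ i) j := by
    intro g i h
    by_cases hg : g = φ i
    · obtain ⟨j, hj⟩ := exists_ne i
      exact ⟨j, hj, by rw [hg]⟩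
    · obtain ⟨j, hj⟩ := exists_lineVal_eq g (φ i)
      refine ⟨j, fun hji => hg (h ?_), hj⟩
      rw [← hji, hj, hji, (hφ i).2]
  have hdiag : ∀ i k, lineVal (φ k) i = 0 → φ k = φ i := fun i k h => by
    rw [hφ.eq_of_lineVal_eq_zero h]
  have hcut : ∀ i, ∀ f ∈ family φ, ∃ v, v ∈ cutEdge (φ i) i ∧ v ∈ f := by
    rintro i f ((⟨g, k, hg, hgk, hgφ, rfl⟩ | ⟨k, rfl⟩) | ⟨k, rfl⟩)
    · by_cases hki : k = i
      · exact ⟨Sum.inr (i, true), inr_mem_cutEdge.2 rfl, inr_mem_lineEdge.2 (by rw [hki])⟩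
      · obtain ⟨j, hji, hj⟩ := key g i fun h =>
          absurd (eq_of_lineVal_eq_zero hg hgk h) hki
        exact ⟨_, some_mem_cutEdge.2 ⟨hji, rfl⟩, mem_lineEdge.2 (by rw [hj])⟩
    · obtain ⟨j, hji, hj⟩ := key (φ k) i (hdiag i k)
      exact ⟨_, some_mem_cutEdge.2 ⟨hji, rfl⟩, mem_plainEdge.2 (by rw [hj])⟩
    · by_cases hki : k = i
      · exact ⟨Sum.inr (i, true), inr_mem_cutEdge.2 rfl, inr_mem_cutEdge.2 (by rw [hki])⟩
      · obtain ⟨j, hji, hj⟩ := key (φ k) i (hdiag i k)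
        refine ⟨Sum.inl (j, some (lineVal (φ i) j)), some_mem_cutEdge.2 ⟨hji, rfl⟩,
          some_mem_cutEdge.2 ⟨fun hjk => hki ?_, hj⟩⟩
        refine hφ.eq_of_lineVal_eq_zero (i := i) ?_
        rw [← hjk, ← hj, hjk, (hφ k).2]
  have hfull : ∀ e ∈ family φ, (∃ g : F × F, ∀ j, Sum.inl (j, some (lineVal g j)) ∈ e) ∨
      ∃ i, e = cutEdge (φ i) i := by
    rintro e ((⟨g, k, -, -, -, rfl⟩ | ⟨k, rfl⟩) | ⟨k, rfl⟩)
    · exact Or.inl ⟨g, fun j => mem_lineEdge.2 rfl⟩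
    · exact Or.inl ⟨φ k, fun j => mem_plainEdge.2 rfl⟩
    · exact Or.inr ⟨k, rfl⟩
  intro e he f hf
  rcases hfull e he with ⟨g, hg⟩ | ⟨i, rfl⟩
  · rcases hfull f hf with ⟨g', hg'⟩ | ⟨i, rfl⟩
    · obtain ⟨j, hj⟩ := exists_lineVal_eq g g'
      exact ⟨_, hg j, hj ▸ hg' j⟩
    · obtain ⟨v, hv, hv'⟩ := hcut i e he
      exact ⟨v, hv', hv⟩
  · exact hcut i f hf

lemma exists_cover_diff_plainEdge (hφ : VanishesOnDiagonal φ) (i : Option F) :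
    ∃ C : Finset (Vertex F), IsCover (↑C) (family φ \ {plainEdge (φ i) i}) ∧
      C.card ≤ Fintype.card F := by
  refine ⟨insert (Sum.inr (i, true)) ((univ.erase (0 : F)).image fun y => Sum.inl (i, some y)),
    ?_, ?_⟩
  · rintro e ⟨(⟨g, k, hg, hgk, hgφ, rfl⟩ | ⟨k, rfl⟩) | ⟨k, rfl⟩, he⟩
    · by_cases hki : k = i
      · exact ⟨Sum.inr (i, true), by simp, inr_mem_lineEdge.2 (by rw [hki])⟩
      · have : lineVal g i ≠ 0 := fun h => hki (eq_of_lineVal_eq_zero hg hgk h)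
        exact ⟨Sum.inl (i, some (lineVal g i)), by simp [this], mem_lineEdge.2 rfl⟩
    · have hki : i ≠ k := by
        rintro rfl
        exact he rfl
      have : lineVal (φ k) i ≠ 0 := fun h => hki (hφ.eq_of_lineVal_eq_zero h)
      exact ⟨Sum.inl (i, some (lineVal (φ k) i)), by simp [this], mem_plainEdge.2 rfl⟩
    · by_cases hki : i = k
      · exact ⟨Sum.inr (i, true), by simp, inr_mem_cutEdge.2 (by rw [hki])⟩
      · have : lineVal (φ k) i ≠ 0 := fun h => hki (hφ.eq_of_lineVal_eq_zero h)
        exact ⟨Sum.inl (i, some (lineVal (φ k) i)), by simp [this], some_mem_cutEdge.2 ⟨hki, rfl⟩⟩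
  · refine (card_insert_le _ _).trans ?_
    have h := card_image_le (s := univ.erase (0 : F))
      (f := fun y => (Sum.inl (i, some y) : Vertex F))
    rw [card_erase_of_mem (mem_univ _), card_univ] at h
    have := Fintype.card_pos (α := F)
    omega

lemma exists_cover_diff_cutEdge (i : Option F) :
    ∃ C : Finset (Vertex F), IsCover (↑C) (family φ \ {cutEdge (φ i) i}) ∧
      C.card ≤ Fintype.card F := by
  refine ⟨(univ : Finset F).image fun y => Sum.inl (i, some y), ?_, card_image_le⟩
  rintro e ⟨(⟨g, k, hg, hgk, hgφ, rfl⟩ | ⟨k, rfl⟩) | ⟨k, rfl⟩, he⟩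
  · exact ⟨Sum.inl (i, some (lineVal g i)), by simp, mem_lineEdge.2 rfl⟩
  · exact ⟨Sum.inl (i, some (lineVal (φ k) i)), by simp, mem_plainEdge.2 rfl⟩
  · have hki : i ≠ k := by
      rintro rfl
      exact he rfl
    exact ⟨Sum.inl (i, some (lineVal (φ k) i)), by simp, some_mem_cutEdge.2 ⟨hki, rfl⟩⟩

/-- If points off the zero line meet every nonzero line vanishing in the column `i`, then at least
`q - 1` of them lie outside this column. -/
lemma card_le_of_covers_pencil {D : Finset (Option F × F)} (hD : ∀ d ∈ D, d.2 ≠ 0) {i : Option F}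
    (h : ∀ g : F × F, g ≠ 0 → lineVal g i = 0 → ∃ d ∈ D, lineVal g d.1 = d.2) :
    Fintype.card F ≤ (D.filter fun d => d.1 ≠ i).card + 1 := by
  obtain ⟨j, hj⟩ := exists_ne i
  choose G hGi hGj using fun c : F => exists_line hj.symm 0 c
  have hG0 : ∀ c ∈ univ.erase (0 : F), G c ≠ 0 := by
    intro c hc h0
    have := hGj c
    rw [h0, lineVal_zero] at this
    exact (mem_erase.1 hc).1 this.symm
  choose! d hdD hd using fun c (hc : c ∈ univ.erase (0 : F)) => h (G c) (hG0 c hc) (hGi c)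
  have hdi : ∀ c ∈ univ.erase (0 : F), (d c).1 ≠ i := by
    intro c hc hi
    refine hD _ (hdD c hc) ?_
    rw [← hd c hc, hi, hGi]
  have hle : (univ.erase (0 : F)).card ≤ (D.filter fun d => d.1 ≠ i).card := by
    refine card_le_card_of_injOn d (fun c hc => ?_) fun c hc c' hc' hcc => ?_
    · exact mem_filter.2 ⟨hdD c hc, hdi c hc⟩
    · have : G c = G c' := by
        refine line_ext (hdi c hc).symm (by rw [hGi, hGi]) ?_
        rw [hd c hc, hcc, hd c' hc']
      rw [← hGj c, this, hGj]
  rw [card_erase_of_mem (mem_univ _), card_univ] at hle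
  omega

/-- The nonzero lines cannot be met by `q ≥ 3` points off the zero line in distinct columns. -/
lemma lt_card_of_covers_lines (hq : 3 ≤ Fintype.card F) {D : Finset (Option F × F)}
    (hinj : ∀ d ∈ D, ∀ d' ∈ D, d.1 = d'.1 → d = d')
    (h : ∀ g : F × F, g ≠ 0 → ∃ d ∈ D, lineVal g d.1 = d.2) :
    Fintype.card F < D.card := by
  by_contra! hcard
  set q := Fintype.card F with hqdef
  let L (d : Option F × F) : Finset (F × F) := univ.filter fun g => lineVal g d.1 = d.2
  have hL (d : Option F × F) : (L d).card ≤ q := by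
    obtain ⟨j, hj⟩ := exists_ne d.1
    rw [hqdef, ← card_univ]
    refine card_le_card_of_injOn (fun g => lineVal g j) (fun _ _ => mem_coe.2 (mem_univ _))
      fun g hg g' hg' hgg => ?_
    have h1 : lineVal g d.1 = d.2 := (mem_filter.1 hg).2
    have h2 : lineVal g' d.1 = d.2 := (mem_filter.1 hg').2
    exact line_ext hj.symm (h1.trans h2.symm) hgg
  obtain ⟨x, hx⟩ : D.Nonempty := by
    obtain ⟨d, hd, -⟩ := h (1, 0) (by simp)
    exact ⟨d, hd⟩
  have hLx : ∀ y ∈ D.erase x, (L y \ L x).card ≤ q - 1 := by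
    intro y hy
    have hyx : y.1 ≠ x.1 := fun hh =>
      (mem_erase.1 hy).1 (hinj y (mem_erase.1 hy).2 x hx hh)
    have hc : (univ.erase x.2).card = q - 1 := by
      rw [card_erase_of_mem (mem_univ _), card_univ]
    rw [← hc]
    refine card_le_card_of_injOn (fun g => lineVal g x.1) (fun g hg => ?_)
      fun g hg g' hg' hgg => ?_
    · have h1 := (mem_sdiff.1 (mem_coe.1 hg)).2
      simp only [L, mem_filter, mem_univ, true_and] at h1
      simpa using h1
    · have h1 : lineVal g y.1 = y.2 := (mem_filter.1 (mem_sdiff.1 (mem_coe.1 hg)).1).2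
      have h2 : lineVal g' y.1 = y.2 := (mem_filter.1 (mem_sdiff.1 (mem_coe.1 hg')).1).2
      exact line_ext hyx (h1.trans h2.symm) hgg
  have hsub : (univ : Finset (F × F)).erase 0 ⊆
      L x ∪ (D.erase x).biUnion fun y => L y \ L x := by
    intro g hg
    obtain ⟨d, hd, hgd⟩ := h g (mem_erase.1 hg).1
    by_cases hgx : g ∈ L x
    · exact mem_union_left _ hgx
    · refine mem_union_right _ (mem_biUnion.2 ⟨d, mem_erase.2 ⟨?_, hd⟩, mem_sdiff.2 ⟨?_, hgx⟩⟩)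
      · rintro rfl
        exact hgx (mem_filter.2 ⟨mem_univ _, hgd⟩)
      · exact mem_filter.2 ⟨mem_univ _, hgd⟩
  have h1 := (card_le_card hsub).trans (card_union_le _ _)
  have h2 := card_biUnion_le_card_mul (D.erase x) (fun y => L y \ L x) (q - 1) hLx
  rw [card_erase_of_mem hx] at h2
  rw [card_erase_of_mem (mem_univ _), card_univ, Fintype.card_prod, ← hqdef] at h1
  have h3 := hL x
  have h4 : (D.card - 1) * (q - 1) ≤ (q - 1) * (q - 1) := Nat.mul_le_mul_right _ (by omega)
  obtain ⟨n, hn⟩ : ∃ n, q = n + 3 := ⟨q - 3, by omega⟩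
  rw [hn] at h1 h2 h3 h4
  have h5 : (n + 3) * (n + 3) - 1 ≤ (n + 3) + (n + 3 - 1) * (n + 3 - 1) := by omega
  have h6 : n + 3 - 1 = n + 2 := rfl
  rw [h6, Nat.sub_le_iff_le_add] at h5
  nlinarith

lemma card_lt_of_isCover_family (hφ : VanishesOnDiagonal φ) (hq : 3 ≤ Fintype.card F)
    {C : Finset (Vertex F)} (hC : IsCover (↑C) (family φ)) : Fintype.card F < C.card := by
  by_contra! hcard
  let A : Finset (Option F) := univ.filter fun i => Sum.inl i ∈ C.image label
  let D : Finset (Option F × F) := univ.filter fun d => Sum.inr d ∈ C.image label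
  have hmemA {i : Option F} : i ∈ A ↔ ∃ v ∈ C, label v = Sum.inl i := by simp [A]
  have hmemD {d : Option F × F} : d ∈ D ↔ ∃ v ∈ C, label v = Sum.inr d := by simp [D]
  have himg : A.disjSum D = C.image label := by
    ext (i | d) <;> simp [A, D]
  have hAD : A.card + D.card ≤ C.card := by
    rw [← card_disjSum, himg]
    exact card_image_le
  have hD0 : ∀ d ∈ D, d.2 ≠ 0 := by
    intro d hd
    obtain ⟨v, -, hv⟩ := hmemD.1 hd
    exact (label_eq_inr_iff.1 hv).1
  have hDmem {j : Option F} {y : F} (hy : y ≠ 0) (h : Sum.inl (j, some y) ∈ C) : (j, y) ∈ D :=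
    hmemD.2 ⟨_, h, label_eq_inr_iff.2 ⟨hy, rfl⟩⟩
  have hcov : ∀ i ∉ A, ∀ g : F × F, g ≠ 0 → lineVal g i = 0 →
      ∃ d ∈ D, lineVal g d.1 = d.2 := by
    intro i hi g hg hgi
    obtain ⟨b, hb⟩ : ∃ b, transversal (fun j => some (lineVal g j)) (i, b) ∈ family φ := by
      by_cases hgφ : ∀ k, g ≠ φ k
      · exact ⟨true, Or.inl (Or.inl ⟨g, i, hg, hgi, hgφ, rfl⟩)⟩
      · push Not at hgφ
        obtain ⟨k, rfl⟩ := hgφ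
        have := hφ.eq_of_lineVal_eq_zero hgi
        subst this
        exact ⟨false, plainEdge_mem_family i⟩
    obtain ⟨v, hvC, hv⟩ := hC _ hb
    rcases v with ⟨j, o⟩ | s
    · rw [inl_mem_transversal] at hv
      subst hv
      by_cases h0 : lineVal g j = 0
      · refine absurd (hmemA.2 ⟨_, hvC, ?_⟩) hi
        rw [h0, eq_of_lineVal_eq_zero hg hgi h0]
        exact label_eq_inl_iff.2 (by simp)
      · exact ⟨_, hDmem h0 hvC, rfl⟩
    · rw [inr_mem_transversal] at hv
      subst hv
      refine absurd (hmemA.2 ⟨_, hvC, ?_⟩) hi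
      cases b <;> exact label_eq_inl_iff.2 (by simp)
  have hpencil : ∀ i ∉ A, Fintype.card F ≤ (D.filter fun d => d.1 ≠ i).card + 1 :=
    fun i hi => card_le_of_covers_pencil hD0 (hcov i hi)
  have hsplit (i : Option F) :
      (D.filter fun d => d.1 = i).card + (D.filter fun d => d.1 ≠ i).card = D.card :=
    card_filter_add_card_filter_not _
  obtain ⟨i₀, hi₀⟩ : ∃ i, i ∉ A := by
    by_contra! hall
    have : A.card = Fintype.card F + 1 := by
      rw [eq_univ_iff_forall.2 hall, card_univ, Fintype.card_option]
    omega
  have h₀ := hpencil i₀ hi₀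
  have h₀' := hsplit i₀
  rcases Nat.eq_zero_or_pos A.card with hA | hA
  · rw [card_eq_zero] at hA
    refine (lt_card_of_covers_lines hq (D := D) ?_ ?_).not_ge (by omega)
    · intro d hd d' hd' hdd
      have h1 := hpencil d.1 (by simp [hA])
      have h2 := hsplit d.1
      have h3 : (D.filter fun e => e.1 = d.1).card ≤ 1 := by omega
      exact card_le_one.1 h3 d (by simp [hd]) d' (by simp [hd', hdd])
    · intro g hg
      obtain ⟨i, hi⟩ := exists_lineVal_eq g 0
      rw [lineVal_zero] at hi
      exact hcov i (by simp [hA]) g hg hi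
  · have hA1 : A.card = 1 := by omega
    obtain ⟨i, hi⟩ := card_eq_one.1 hA1
    have hDi : ∀ d ∈ D, d.1 = i := by
      intro d hd
      by_contra hdi
      have h1 := hpencil d.1 (by simp [hi, hdi])
      have h2 := hsplit d.1
      have h3 : 0 < (D.filter fun e => e.1 = d.1).card :=
        card_pos.2 ⟨d, by simp [hd]⟩
      omega
    have hval : ∀ j, Sum.inl (j, some (lineVal (φ i) j)) ∈ C → j = i := by
      intro j hj
      by_cases h0 : lineVal (φ i) j = 0
      · exact hφ.eq_of_lineVal_eq_zero h0
      · exact hDi _ (hDmem h0 hj)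
    obtain ⟨u, huC, hu⟩ : ∃ u ∈ C, u = Sum.inl (i, some 0) ∨ u = Sum.inr (i, false) := by
      obtain ⟨u, huC, hu⟩ := hC _ (plainEdge_mem_family i)
      refine ⟨u, huC, ?_⟩
      rcases u with ⟨j, o⟩ | s
      · rw [mem_plainEdge] at hu
        subst hu
        have := hval j huC
        subst this
        exact Or.inl (by rw [(hφ j).2])
      · exact Or.inr (by rw [inr_mem_plainEdge.1 hu])
    obtain ⟨v, hvC, hv⟩ : ∃ v ∈ C, v = Sum.inl (i, none) ∨ v = Sum.inr (i, true) := by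
      obtain ⟨v, hvC, hv⟩ := hC _ (cutEdge_mem_family i)
      refine ⟨v, hvC, ?_⟩
      rcases v with ⟨j, _ | y⟩ | s
      · exact Or.inl (by rw [none_mem_cutEdge.1 hv])
      · obtain ⟨hji, rfl⟩ := some_mem_cutEdge.1 hv
        exact absurd (hval j hvC) hji
      · exact Or.inr (by rw [inr_mem_cutEdge.1 hv])
    have huv : u ≠ v := by
      rcases hu with rfl | rfl <;> rcases hv with rfl | rfl <;> simp
    have hlabel : label u = label v := by
      have hu' : label u = Sum.inl i := label_eq_inl_iff.2 (by tauto)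
      have hv' : label v = Sum.inl i := label_eq_inl_iff.2 (by tauto)
      rw [hu', hv']
    have hlt : (C.image label).card < C.card := by
      refine lt_of_le_of_ne card_image_le fun heq => huv ?_
      exact card_image_iff.1 heq huC hvC hlabel
    rw [← himg, card_disjSum] at hlt
    omega

lemma card_inter_lineEdge_le {_ : DecidableEq (Vertex F)} {g : F × F} {i : Option F}
    {f : Finset (Vertex F)} {g' : F × F} (hgg' : g ≠ g')
    (hf : ∀ j y, Sum.inl (j, some y) ∈ f → lineVal g' j = y) :
    (lineEdge g i ∩ f).card ≤ 2 := by
  obtain ⟨j₀, hj₀⟩ := exists_lineVal_eq g g'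
  have hsub : lineEdge g i ∩ f ⊆ {Sum.inl (j₀, some (lineVal g j₀)), Sum.inr (i, true)} := by
    intro v hv
    obtain ⟨hvg, hvf⟩ := mem_inter.1 hv
    rcases v with ⟨j, o⟩ | s
    · rw [mem_lineEdge] at hvg
      subst hvg
      have hj := hf j _ hvf
      have : j = j₀ := by
        by_contra hne
        exact hgg' (line_ext hne hj.symm hj₀)
      simp [this]
    · simp [inr_mem_lineEdge.1 hvg]
  exact (card_le_card hsub).trans card_le_two

lemma plainEdge_ne_cutEdge (g g' : F × F) (i j : Option F) : plainEdge g i ≠ cutEdge g' j := by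
  intro h
  have : Sum.inl (j, none) ∈ plainEdge g i := by
    rw [h]
    exact none_mem_cutEdge.2 rfl
  simp [mem_plainEdge] at this

lemma three_le_card_inter {_ : DecidableEq (Vertex F)} (hq : 3 ≤ Fintype.card F)
    (g : F × F) (i : Option F) : 3 ≤ (plainEdge g i ∩ cutEdge g i).card := by
  have hinj : Function.Injective fun j : Option F => (Sum.inl (j, some (lineVal g j)) : Vertex F) :=
    fun j k h => congrArg Prod.fst (Sum.inl_injective h)
  have hsub : (univ.erase i).image (fun j => Sum.inl (j, some (lineVal g j))) ⊆
      plainEdge g i ∩ cutEdge g i := by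
    intro v hv
    obtain ⟨j, hj, rfl⟩ := mem_image.1 hv
    exact mem_inter.2 ⟨mem_plainEdge.2 rfl, some_mem_cutEdge.2 ⟨(mem_erase.1 hj).1, rfl⟩⟩
  have h := card_le_card hsub
  rw [card_image_of_injective _ hinj, card_erase_of_mem (mem_univ _), card_univ,
    Fintype.card_option] at h
  omega

lemma core_eq (hq : 3 ≤ Fintype.card F) {H : Set (Finset (Vertex F))} (hH : H ⊆ family φ)
    (hplain : ∀ i, plainEdge (φ i) i ∈ H) (hcut : ∀ i, cutEdge (φ i) i ∈ H) :
    core H = {e | ∃ i, e = plainEdge (φ i) i} ∪ {e | ∃ i, e = cutEdge (φ i) i} := by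
  ext e
  constructor
  · rintro ⟨he, f, hf, hfe, hcard⟩
    rcases hH he with (⟨g, i, hg, hgi, hgφ, rfl⟩ | he) | he
    · exfalso
      obtain ⟨g', hgg', hg'⟩ : ∃ g', g ≠ g' ∧ ∀ j y, Sum.inl (j, some y) ∈ f → lineVal g' j = y := by
        rcases hH hf with (⟨g', k, hg', hgk, -, rfl⟩ | ⟨k, rfl⟩) | ⟨k, rfl⟩
        · refine ⟨g', ?_, fun j y h => Option.some_injective _ (mem_lineEdge.1 h)⟩
          rintro rfl
          exact hfe (by rw [eq_of_lineVal_eq_zero hg hgi hgk])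
        · exact ⟨φ k, hgφ k, fun j y h => Option.some_injective _ (mem_plainEdge.1 h)⟩
        · exact ⟨φ k, hgφ k, fun j y h => (some_mem_cutEdge.1 h).2⟩
      exact absurd (hcard.trans (card_inter_lineEdge_le hgg' hg')) (by norm_num)
    · exact Or.inl he
    · exact Or.inr he
  · rintro (⟨i, rfl⟩ | ⟨i, rfl⟩)
    · exact ⟨hplain i, _, hcut i, (plainEdge_ne_cutEdge _ _ _ _).symm, three_le_card_inter hq _ _⟩
    · refine ⟨hcut i, _, hplain i, plainEdge_ne_cutEdge _ _ _ _, ?_⟩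
      refine le_of_le_of_eq ?_ (congrArg card (@inter_comm _ (_) _ _))
      exact three_le_card_inter hq _ _

lemma plainEdge_injective : Function.Injective fun i => plainEdge (φ i) i := by
  intro i j h
  have : Sum.inr (i, false) ∈ plainEdge (φ j) j := by
    rw [← show plainEdge (φ i) i = plainEdge (φ j) j from h]
    exact inr_mem_plainEdge.2 rfl
  simpa using inr_mem_plainEdge.1 this

lemma cutEdge_injective : Function.Injective fun i => cutEdge (φ i) i := by
  intro i j h
  have : Sum.inl (i, none) ∈ cutEdge (φ j) j := by
    rw [← show cutEdge (φ i) i = cutEdge (φ j) j from h]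
    exact none_mem_cutEdge.2 rfl
  exact none_mem_cutEdge.1 this

lemma coreDegree_inl_some (hφ : VanishesOnDiagonal φ) {H : Set (Finset (Vertex F))}
    (hcore : core H = {e | ∃ i, e = plainEdge (φ i) i} ∪ {e | ∃ i, e = cutEdge (φ i) i})
    (j : Option F) {y : F} (hy : y ≠ 0) :
    coreDegree H (Sum.inl (j, some y)) = 2 * (univ.filter fun i => lineVal (φ i) j = y).card := by
  set S : Finset (Option F) := univ.filter fun i => lineVal (φ i) j = y with hS
  have hset : {e | e ∈ core H ∧ Sum.inl (j, some y) ∈ e} =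
      ↑(S.image (fun i => plainEdge (φ i) i) ∪ S.image fun i => cutEdge (φ i) i) := by
    ext e
    simp only [hcore, Set.mem_ofPred_eq, Set.mem_union, coe_union, coe_image, Set.mem_image,
      mem_coe, hS, mem_filter, mem_univ, true_and]
    constructor
    · rintro ⟨⟨i, rfl⟩ | ⟨i, rfl⟩, h⟩
      · exact Or.inl ⟨i, Option.some_injective _ (mem_plainEdge.1 h), rfl⟩
      · exact Or.inr ⟨i, (some_mem_cutEdge.1 h).2, rfl⟩
    · rintro (⟨i, h, rfl⟩ | ⟨i, h, rfl⟩)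
      · exact ⟨Or.inl ⟨i, rfl⟩, mem_plainEdge.2 (by rw [h])⟩
      · refine ⟨Or.inr ⟨i, rfl⟩, some_mem_cutEdge.2 ⟨?_, h⟩⟩
        rintro rfl
        exact hy (h.symm.trans (hφ j).2)
  have hdisj : Disjoint (S.image fun i => plainEdge (φ i) i) (S.image fun i => cutEdge (φ i) i) := by
    refine disjoint_left.2 fun e he he' => ?_
    obtain ⟨i, -, rfl⟩ := mem_image.1 he
    obtain ⟨k, -, hk⟩ := mem_image.1 he'
    exact plainEdge_ne_cutEdge _ _ _ _ hk.symm
  rw [coreDegree, hset, Set.ncard_coe_finset, card_union_of_disjoint hdisj,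
    card_image_of_injective _ plainEdge_injective, card_image_of_injective _ cutEdge_injective,
    two_mul]

lemma coreDegree_le_one (hφ : VanishesOnDiagonal φ) {H : Set (Finset (Vertex F))}
    (hcore : core H = {e | ∃ i, e = plainEdge (φ i) i} ∪ {e | ∃ i, e = cutEdge (φ i) i})
    {x : Vertex F} (hx : ∀ j y, x = Sum.inl (j, some y) → y = 0) : coreDegree H x ≤ 1 := by
  rw [coreDegree, hcore, Set.ncard_le_one (Set.toFinite _)]
  rcases x with ⟨j, _ | y⟩ | ⟨j, b⟩
  · have : ∀ e ∈ {e : Finset (Vertex F) | e ∈ {e | ∃ i, e = plainEdge (φ i) i} ∪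
        {e | ∃ i, e = cutEdge (φ i) i} ∧ Sum.inl (j, none) ∈ e}, e = cutEdge (φ j) j := by
      rintro e ⟨⟨i, rfl⟩ | ⟨i, rfl⟩, h⟩
      · simp [mem_plainEdge] at h
      · rw [none_mem_cutEdge.1 h]
    exact fun e he f hf => (this e he).trans (this f hf).symm
  · obtain rfl := hx j y rfl
    have : ∀ e ∈ {e : Finset (Vertex F) | e ∈ {e | ∃ i, e = plainEdge (φ i) i} ∪
        {e | ∃ i, e = cutEdge (φ i) i} ∧ Sum.inl (j, some 0) ∈ e}, e = plainEdge (φ j) j := by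
      rintro e ⟨⟨i, rfl⟩ | ⟨i, rfl⟩, h⟩
      · rw [hφ.eq_of_lineVal_eq_zero (Option.some_injective _ (mem_plainEdge.1 h))]
      · obtain ⟨hji, h⟩ := some_mem_cutEdge.1 h
        exact absurd (hφ.eq_of_lineVal_eq_zero h) hji
    exact fun e he f hf => (this e he).trans (this f hf).symm
  · have : ∀ e ∈ {e : Finset (Vertex F) | e ∈ {e | ∃ i, e = plainEdge (φ i) i} ∪
        {e | ∃ i, e = cutEdge (φ i) i} ∧ Sum.inr (j, b) ∈ e},
        e = bif b then cutEdge (φ j) j else plainEdge (φ j) j := by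
      rintro e ⟨⟨i, rfl⟩ | ⟨i, rfl⟩, h⟩
      · have := inr_mem_plainEdge.1 h
        simp only [Prod.mk.injEq] at this
        rw [this.1, this.2, cond_false]
      · have := inr_mem_cutEdge.1 h
        simp only [Prod.mk.injEq] at this
        rw [this.1, this.2, cond_true]
    exact fun e he f hf => (this e he).trans (this f hf).symm

lemma exists_coreDegree_eq_iff (hφ : VanishesOnDiagonal φ) {H : Set (Finset (Vertex F))}
    (hcore : core H = {e | ∃ i, e = plainEdge (φ i) i} ∪ {e | ∃ i, e = cutEdge (φ i) i})
    {n : ℕ} (hn : 0 < n) :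
    (∃ x, coreDegree H x = 2 * n) ↔
      ∃ j, ∃ y ≠ 0, (univ.filter fun i => lineVal (φ i) j = y).card = n := by
  constructor
  · rintro ⟨x, hx⟩
    obtain ⟨j, y, rfl, hy⟩ : ∃ j y, x = Sum.inl (j, some y) ∧ y ≠ 0 := by
      by_contra! hcon
      have := coreDegree_le_one hφ hcore hcon
      omega
    rw [coreDegree_inl_some hφ hcore j hy] at hx
    exact ⟨j, y, hy, by omega⟩
  · rintro ⟨j, y, hy, h⟩
    exact ⟨Sum.inl (j, some y), by rw [coreDegree_inl_some hφ hcore j hy, h]⟩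

lemma card_slopeLines_none (f : F → F) {y : F} (hy : y ≠ 0) :
    (univ.filter fun i => lineVal (slopeLines f i) none = y).card =
      (univ.filter fun i => f i = y).card := by
  have : (univ.filter fun i => lineVal (slopeLines f i) none = y) =
      (univ.filter fun i => f i = y).map Function.Embedding.some := by
    ext (_ | i) <;> simp only [mem_filter, mem_univ, true_and, mem_map] <;>
      simp [slopeLines, lineVal, hy.symm]
  rw [this, card_map]

lemma card_slopeLines_some_le {f : F → F} (hf : ∀ i, f i ≠ 0) (x y : F) :
    (univ.filter fun i => lineVal (slopeLines f i) (some x) = y).card ≤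
      (univ.image f).card + 1 := by
  rw [← card_insertNone]
  refine card_le_card_of_injOn (Option.map f) (fun i hi => ?_) fun i hi k hk hik => ?_
  · cases i <;> simp
  · rcases i with _ | i <;> rcases k with _ | k
    · rfl
    · simp at hik
    · simp at hik
    · have hfik : f i = f k := by simpa using hik
      have h1 : f i * x + -(f i * i) = y := (mem_filter.1 hi).2
      have h2 : f k * x + -(f k * k) = y := (mem_filter.1 hk).2
      rw [← hfik] at h2
      have : f i * i = f i * k := by linear_combination h2 - h1
      rw [mul_left_cancel₀ (hf i) this]

lemma exists_card_slopeLines_eq_iff {f : F → F} (hf : ∀ i, f i ≠ 0) {n : ℕ}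
    (hn : (univ.image f).card + 1 < n) :
    (∃ j, ∃ y ≠ 0, (univ.filter fun i => lineVal (slopeLines f i) j = y).card = n) ↔
      ∃ y ≠ 0, (univ.filter fun i => f i = y).card = n := by
  constructor
  · rintro ⟨_ | x, y, hy, h⟩
    · exact ⟨y, hy, by rw [← card_slopeLines_none f hy, h]⟩
    · have := card_slopeLines_some_le hf x y
      omega
  · rintro ⟨y, hy, h⟩
    exact ⟨none, y, hy, by rw [card_slopeLines_none f hy, h]⟩

/-- Slopes `f` yield a minimal Ryser hypergraph that determines the large fibre sizes of `f`. -/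
lemma exists_minimal_ryser {q : ℕ} (hq : 3 ≤ q) (hF : Fintype.card F = q) {f : F → F}
    (hf : ∀ i, f i ≠ 0) :
    ∃ H : Set (Finset (Vertex F)),
      (∃ sides : Fin (q + 2) → Set (Vertex F), Partite H sides) ∧
      Uniform H (q + 2) ∧ Intersecting H ∧
      coverNumber H = q + 1 ∧
      (∀ e ∈ H, coverNumber (H \ {e}) = q) ∧
      ∀ n, (Set.range f).ncard + 1 < n →
        ((∃ x, coreDegree H x = 2 * n) ↔ ∃ y ≠ 0, {i | f i = y}.ncard = n) := by
  subst hF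
  have hφ := vanishesOnDiagonal_slopeLines hf
  obtain ⟨H, hH, hlow, hcrit⟩ := exists_critical (Set.toFinite (family (slopeLines f)))
    fun C hC => card_lt_of_isCover_family hφ hq hC
  have hunif : Uniform H (Fintype.card F + 2) := fun e he => uniform_family e (hH he)
  have hne : ∀ e ∈ H, e.Nonempty := fun e he => card_pos.1 (by rw [hunif e he]; omega)
  have hmem : ∀ e, (∃ C : Finset (Vertex F), IsCover (↑C) (family (slopeLines f) \ {e}) ∧
      C.card ≤ Fintype.card F) → e ∈ H := by
    rintro e ⟨C, hC, hcard⟩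
    by_contra he
    refine (hlow C fun f hf => hC f ⟨hH hf, ?_⟩).not_ge hcard
    rintro rfl
    exact he hf
  have hcore := core_eq hq hH (fun i => hmem _ (exists_cover_diff_plainEdge hφ i))
    fun i => hmem _ (exists_cover_diff_cutEdge i)
  obtain ⟨h1, h2⟩ := coverNumber_of_critical hne hlow hcrit
  refine ⟨H, exists_partite_family hH, hunif,
    fun e he e' he' => intersecting_family hφ e (hH he) e' (hH he'), h1, h2, fun n hn => ?_⟩
  have himage : (univ.image f).card = (Set.range f).ncard := by
    rw [← Set.ncard_coe_finset]
    simp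
  have hfibre (y : F) : (univ.filter fun i => f i = y).card = {i | f i = y}.ncard := by
    rw [← Set.ncard_coe_finset]
    simp
  rw [exists_coreDegree_eq_iff hφ hcore (by omega),
    exists_card_slopeLines_eq_iff hf (by rwa [himage])]
  simp only [hfibre]

end Lines

/-- A map on `ZMod p` whose fibre over each `a ∈ A` has exactly `a` elements, all other elements
being sent to `1`. -/
def blockMap (p M : ℕ) (A : Finset ℕ) (x : ZMod p) : ZMod p :=
  if x.val / M ∈ A ∧ x.val % M < x.val / M then ((x.val / M : ℕ) : ZMod p) else 1

section BlockMap

variable {p M : ℕ} [Fact p.Prime] {A : Finset ℕ}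

lemma blockMap_ne_zero (hMp : M ≤ p) (hA : ∀ a ∈ A, 1 < a ∧ a < M) (x : ZMod p) :
    blockMap p M A x ≠ 0 := by
  rw [blockMap]
  split_ifs with h
  · obtain ⟨h1, h2⟩ := hA _ h.1
    rw [Ne, ZMod.natCast_eq_zero_iff]
    exact fun hd => (Nat.le_of_dvd (by omega) hd).not_gt (by omega)
  · exact one_ne_zero

lemma blockMap_eq_iff (hMp : M ≤ p) (hA : ∀ a ∈ A, 1 < a ∧ a < M) {a : ℕ} (ha : a ∈ A)
    (x : ZMod p) : blockMap p M A x = (a : ZMod p) ↔ x.val / M = a ∧ x.val % M < a := by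
  have hcast : ∀ b, b < M → ((b : ZMod p) = (a : ZMod p) ↔ b = a) := by
    intro b hb
    rw [ZMod.natCast_eq_natCast_iff']
    rw [Nat.mod_eq_of_lt (hb.trans_le hMp), Nat.mod_eq_of_lt ((hA a ha).2.trans_le hMp)]
  have ha1 := hA a ha
  rw [blockMap]
  split_ifs with h
  · rw [hcast _ (hA _ h.1).2]
    constructor
    · intro h'
      exact ⟨h', h' ▸ h.2⟩
    · exact fun h' => h'.1
  · have h1 : ((1 : ZMod p) = (a : ZMod p) ↔ 1 = a) := by
      have := hcast 1 (by omega)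
      rwa [Nat.cast_one] at this
    rw [h1]
    constructor
    · omega
    · rintro ⟨h2, h3⟩
      exact absurd ⟨h2 ▸ ha, h2 ▸ h3⟩ h

lemma image_blockMap_subset :
    univ.image (blockMap p M A) ⊆ insert 1 (A.image fun a : ℕ => (a : ZMod p)) := by
  intro y hy
  obtain ⟨x, -, rfl⟩ := mem_image.1 hy
  rw [blockMap]
  split_ifs with h
  · exact mem_insert_of_mem (mem_image_of_mem (fun a : ℕ => (a : ZMod p)) h.1)
  · exact mem_insert_self _ _

lemma ncard_range_blockMap_le : (Set.range (blockMap p M A)).ncard ≤ A.card + 1 := by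
  rw [← Set.image_univ, ← coe_univ, ← coe_image, Set.ncard_coe_finset]
  exact (card_le_card image_blockMap_subset).trans
    ((card_insert_le _ _).trans (Nat.succ_le_succ card_image_le))

lemma card_fibre_blockMap (hMp : M * M ≤ p) (hA : ∀ a ∈ A, 1 < a ∧ a < M) {a : ℕ} (ha : a ∈ A) :
    (univ.filter fun x => blockMap p M A x = (a : ZMod p)).card = a := by
  have ha1 := hA a ha
  have hM : M ≤ p := (Nat.le_mul_self M).trans hMp
  have hlt : ∀ b < a, a * M + b < p := fun b hb => by nlinarith
  have hset : (univ.filter fun x => blockMap p M A x = (a : ZMod p)) =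
      (range a).image fun b : ℕ => ((a * M + b : ℕ) : ZMod p) := by
    ext x
    rw [mem_filter, blockMap_eq_iff hM hA ha, mem_image]
    simp only [mem_univ, true_and, mem_range]
    constructor
    · rintro ⟨h1, h2⟩
      refine ⟨x.val % M, h2, ?_⟩
      rw [← h1, mul_comm, Nat.div_add_mod, ZMod.natCast_zmod_val]
    · rintro ⟨b, hb, rfl⟩
      rw [ZMod.val_natCast_of_lt (hlt b hb)]
      have hbM : b < M := by omega
      constructor
      · rw [mul_comm, Nat.mul_add_div (by omega), Nat.div_eq_of_lt hbM, add_zero]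
      · rw [mul_comm, Nat.mul_add_mod, Nat.mod_eq_of_lt hbM]
        exact hb
  rw [hset, card_image_of_injOn, card_range]
  intro b hb b' hb' hbb
  have h := congrArg ZMod.val hbb
  simp only [ZMod.val_natCast_of_lt (hlt b (mem_range.1 hb)),
    ZMod.val_natCast_of_lt (hlt b' (mem_range.1 hb'))] at h
  omega

lemma le_card_fibre_blockMap_one (hMp : M ≤ p) (h0 : 0 ∉ A) :
    M ≤ (univ.filter fun x => blockMap p M A x = 1).card := by
  have hlt : ∀ b < M, b < p := fun b hb => hb.trans_le hMp
  calc M = ((range M).image fun b : ℕ => (b : ZMod p)).card := by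
        rw [card_image_of_injOn, card_range]
        intro b hb b' hb' hbb
        have h := congrArg ZMod.val hbb
        simpa only [ZMod.val_natCast_of_lt (hlt b (mem_range.1 hb)),
          ZMod.val_natCast_of_lt (hlt b' (mem_range.1 hb'))] using h
    _ ≤ _ := by
        refine card_le_card fun x hx => ?_
        obtain ⟨b, hb, rfl⟩ := mem_image.1 hx
        have hb := mem_range.1 hb
        rw [mem_filter, blockMap, ZMod.val_natCast_of_lt (hlt b hb), Nat.div_eq_of_lt hb]
        simp [h0]

lemma exists_ncard_fibre_blockMap_iff (hMp : M * M ≤ p) (hA : ∀ a ∈ A, 1 < a ∧ a < M) {n : ℕ}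
    (hn : 1 < n) (hnM : n < M) :
    (∃ y ≠ 0, {x | blockMap p M A x = y}.ncard = n) ↔ n ∈ A := by
  have hfibre (y : ZMod p) :
      {x | blockMap p M A x = y}.ncard = (univ.filter fun x => blockMap p M A x = y).card := by
    rw [← Set.ncard_coe_finset]
    simp
  simp only [hfibre]
  have hM : M ≤ p := (Nat.le_mul_self M).trans hMp
  constructor
  · rintro ⟨y, -, h⟩
    obtain ⟨x, hx⟩ := card_pos.1 (h ▸ Nat.zero_lt_of_lt hn)
    have hy : y ∈ univ.image (blockMap p M A) :=
      mem_image.2 ⟨x, mem_univ _, (mem_filter.1 hx).2⟩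
    rcases mem_insert.1 (image_blockMap_subset hy) with rfl | hy
    · have := le_card_fibre_blockMap_one (p := p) hM fun h0 => absurd (hA 0 h0).1 (by norm_num)
      omega
    · obtain ⟨a, ha, rfl⟩ := mem_image.1 hy
      rw [card_fibre_blockMap hMp hA ha] at h
      exact h ▸ ha
  · intro h
    refine ⟨(n : ZMod p), ?_, card_fibre_blockMap hMp hA h⟩
    rw [Ne, ZMod.natCast_eq_zero_iff]
    exact fun hd => (Nat.le_of_dvd (by omega) hd).not_gt (by omega)

end BlockMap

lemma exists_pairwise_nonisomorphic {p K : ℕ} (hp : p.Prime)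
    (hK : (2 * K + 3) * (2 * K + 3) ≤ p) :
    ∃ Hs : Finset (Fin K) → Set (Finset (Vertex (ZMod p))),
      (∀ A, (∃ sides : Fin (p + 2) → Set (Vertex (ZMod p)), Partite (Hs A) sides) ∧
        Uniform (Hs A) (p + 2) ∧ Intersecting (Hs A) ∧ coverNumber (Hs A) = p + 1 ∧
        ∀ e ∈ Hs A, coverNumber (Hs A \ {e}) = p) ∧
      ∀ A B, Isomorphic (Hs A) (Hs B) → A = B := by
  have : Fact p.Prime := ⟨hp⟩
  have hp3 : 3 ≤ p := by nlinarith
  let sizes (A : Finset (Fin K)) : Finset ℕ := A.image fun k : Fin K => K + 3 + (k : ℕ)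
  have hsizes (A : Finset (Fin K)) : ∀ a ∈ sizes A, 1 < a ∧ a < 2 * K + 3 := by
    intro a ha
    obtain ⟨k, -, rfl⟩ := mem_image.1 ha
    omega
  have hcard (A : Finset (Fin K)) :
      (Set.range (blockMap p (2 * K + 3) (sizes A))).ncard ≤ K + 1 := by
    refine ncard_range_blockMap_le.trans (Nat.succ_le_succ (card_image_le.trans ?_))
    simpa using card_le_univ A
  have hmem (A : Finset (Fin K)) (k : Fin K) : K + 3 + (k : ℕ) ∈ sizes A ↔ k ∈ A := by
    constructor
    · intro h
      obtain ⟨l, hl, hkl⟩ := mem_image.1 h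
      have : l = k := Fin.ext (by simpa using hkl)
      exact this ▸ hl
    · exact fun h => mem_image.2 ⟨k, h, rfl⟩
  choose Hs hpart hunif hint hcov hcrit hdeg using fun A : Finset (Fin K) =>
    exists_minimal_ryser hp3 (ZMod.card p)
      (blockMap_ne_zero ((Nat.le_mul_self _).trans hK) (hsizes A))
  refine ⟨Hs, fun A => ⟨hpart A, hunif A, hint A, hcov A, hcrit A⟩, fun A B hAB => ?_⟩
  have hchar (A : Finset (Fin K)) (k : Fin K) :
      (∃ x, coreDegree (Hs A) x = 2 * (K + 3 + (k : ℕ))) ↔ k ∈ A := by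
    have hA := hcard A
    rw [hdeg A _ (by omega), exists_ncard_fibre_blockMap_iff hK (hsizes A) (by omega) (by omega),
      hmem]
  ext k
  rw [← hchar A, ← hchar B, Isomorphic.exists_coreDegree_eq_iff hAB]

lemma eventually_exp_rpow_le {δ : ℝ} (hδ0 : 0 < δ) (hδ : δ < 1 / 2) :
    ∀ᶠ K : ℕ in Filter.atTop, ∀ r : ℕ, r ≤ 75 * K ^ 2 →
      Real.exp ((r : ℝ) ^ ((1 : ℝ) / 2 - δ)) ≤ ((2 ^ K : ℕ) : ℝ) := by
  have hlog : 0 < Real.log 2 := Real.log_pos (by norm_num)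
  have htop : Filter.Tendsto (fun K : ℕ => 75 * (K : ℝ) ^ 2) Filter.atTop Filter.atTop :=
    ((Filter.tendsto_pow_atTop two_ne_zero).comp tendsto_natCast_atTop_atTop).const_mul_atTop
      (by norm_num)
  have hlim := (tendsto_rpow_neg_atTop hδ0).comp htop
  have hev := hlim.eventually_lt_const (u := Real.log 2 / 9) (by positivity)
  filter_upwards [hev, Filter.eventually_gt_atTop 0] with K hK hK0 r hr
  have hK0' : (0 : ℝ) < K := by exact_mod_cast hK0
  have hr' : (r : ℝ) ≤ 75 * (K : ℝ) ^ 2 := by exact_mod_cast hr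
  have hsqrt : (75 * (K : ℝ) ^ 2) ^ ((1 : ℝ) / 2) ≤ 9 * K := by
    rw [← Real.sqrt_eq_rpow]
    exact Real.sqrt_le_iff.2 ⟨by positivity, by nlinarith⟩
  have hkey : (r : ℝ) ^ ((1 : ℝ) / 2 - δ) ≤ K * Real.log 2 := by
    calc (r : ℝ) ^ ((1 : ℝ) / 2 - δ) ≤ (75 * (K : ℝ) ^ 2) ^ ((1 : ℝ) / 2 - δ) :=
          Real.rpow_le_rpow (by positivity) hr' (by linarith)
      _ = (75 * (K : ℝ) ^ 2) ^ ((1 : ℝ) / 2) * (75 * (K : ℝ) ^ 2) ^ (-δ) := by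
          rw [← Real.rpow_add (by positivity), sub_eq_add_neg]
      _ ≤ 9 * K * (Real.log 2 / 9) :=
          mul_le_mul hsqrt hK.le (by positivity) (by positivity)
      _ = K * Real.log 2 := by ring
  calc Real.exp ((r : ℝ) ^ ((1 : ℝ) / 2 - δ)) ≤ Real.exp (K * Real.log 2) :=
        Real.exp_le_exp.2 hkey
    _ = ((2 ^ K : ℕ) : ℝ) := by
        rw [Real.exp_nat_mul, Real.exp_log (by norm_num)]
        push_cast
        rfl

end Ryser

theorem statement_2 (δ : ℝ) (hδ0 : 0 < δ) (hδ : δ < 1 / 2) (N : ℕ) :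
    ∃ r : ℕ, N ≤ r ∧
      ∃ (n : ℕ) (W : Type) (Hs : Fin n → Set (Finset W)),
        Real.exp ((r : ℝ) ^ ((1 : ℝ) / 2 - δ)) ≤ (n : ℝ) ∧
        (∀ k : Fin n,
          (∃ sides : Fin r → Set W, Partite (Hs k) sides) ∧
          Uniform (Hs k) r ∧ Intersecting (Hs k) ∧ coverNumber (Hs k) = r - 1 ∧
          ∀ e ∈ Hs k, coverNumber (Hs k \ {e}) = r - 2) ∧
        ∀ k l : Fin n, k ≠ l → ¬ Isomorphic (Hs k) (Hs l) := by
  obtain ⟨K, hK, hKN⟩ := ((Ryser.eventually_exp_rpow_le hδ0 hδ).and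
    (Filter.eventually_ge_atTop (N + 1))).exists
  obtain ⟨p, hp, hp1, hp2⟩ := Nat.exists_prime_lt_and_le_two_mul ((2 * K + 3) * (2 * K + 3))
    (by positivity)
  obtain ⟨Hs, hHs, hiso⟩ := Ryser.exists_pairwise_nonisomorphic hp hp1.le
  let ε : Fin (2 ^ K) ≃ Finset (Fin K) := (Fintype.equivFinOfCardEq (by simp)).symm
  refine ⟨p + 2, by nlinarith, 2 ^ K, Ryser.Vertex (ZMod p), fun k => Hs (ε k),
    hK _ (by nlinarith), fun k => hHs (ε k), fun k l hkl h => hkl (ε.injective (hiso _ _ h))⟩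

end
end

section
/- Let r ≥ 5, let T_r be a truncated projective plane of uniformity r, let S = {s_1,…,s_r} be an edge of T_r with s_i ∈ V_i, let F_1,…,F_r be edges of T_r with S ∩ F_i = {s_i}, and set H = H(T_r,S,F_1,…,F_r). Let G be an intersecting (r+1)-partite hypergraph, possibly on a larger vertex set, whose sides restricted to the vertices of H are V_1,…,V_{r+1}, and suppose H ⊆ G. Then every edge E ∈ G \ H satisfies |E| = r+1 and there exist i ∈ {1,…,r} and a vertex v such that either E = F_i ∪ {v} or E = (F_i \ {s_i}) ∪ {v_i, v}. -/
open Finset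

noncomputable section
open scoped Classical

open Configuration

section Plane

lemma exists_point_on_both (P : Type*) {L : Type*} [Membership P L]
    [Configuration.ProjectivePlane P L] {k ℓ : L} (h : k ≠ ℓ) : ∃ x : P, x ∈ k ∧ x ∈ ℓ :=
  ⟨_, HasPoints.mkPoint_ax h⟩

variable {P L : Type*} [Membership P L] [Fintype P] [Fintype L]
  [Configuration.ProjectivePlane P L]

lemma card_filter_mem_line (ℓ : L) :
    (univ.filter fun x : P => x ∈ ℓ).card = ProjectivePlane.order P L + 1 := by
  rw [← ProjectivePlane.pointCount_eq P ℓ, pointCount, Nat.card_eq_fintype_card,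
    Fintype.card_subtype]

lemma card_filter_line_mem (x : P) :
    (univ.filter fun ℓ : L => x ∈ ℓ).card = ProjectivePlane.order P L + 1 := by
  rw [← ProjectivePlane.lineCount_eq L x, lineCount, Nat.card_eq_fintype_card,
    Fintype.card_subtype]

variable (L) in
lemma exists_line_through (x y : P) : ∃ ℓ : L, x ∈ ℓ ∧ y ∈ ℓ := by
  by_cases h : x = y
  · have : 0 < (univ.filter fun ℓ : L => x ∈ ℓ).card := by
      rw [card_filter_line_mem]; omega
    obtain ⟨ℓ, hℓ⟩ := card_pos.1 this
    simp only [mem_filter, mem_univ, true_and] at hℓ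
    exact ⟨ℓ, hℓ, h ▸ hℓ⟩
  · exact ⟨_, HasLines.mkLine_ax h⟩

/-- If `X` misses the line `M`, contains no two points collinear with `w ∈ M`, and meets every
line that avoids `w`, `a`, `b` (all on `M`), then `X` consists of all points other than `a`, or
all points other than `b`, of a line through that point. -/
lemma exists_line_erase_eq (hq : 3 ≤ ProjectivePlane.order P L) {M : L} {w a b : P}
    (hw : w ∈ M) (ha : a ∈ M) (hb : b ∈ M) (X : Finset P) (hXM : ∀ x ∈ X, x ∉ M)
    (hX : ∀ x ∈ X, ∀ y ∈ X, ∀ ℓ : L, w ∈ ℓ → x ∈ ℓ → y ∈ ℓ → x = y)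
    (hmeet : ∀ ℓ : L, w ∉ ℓ → a ∉ ℓ → b ∉ ℓ → ∃ x ∈ X, x ∈ ℓ) :
    ∃ ℓ : L, ℓ ≠ M ∧ ∃ c, (c = a ∨ c = b) ∧ c ∈ ℓ ∧ ∀ x ∈ ℓ, x ≠ c → x ∈ X := by
  choose g hg₁ hg₂ using exists_line_through (P := P) L
  have hgM : ∀ x ∈ X, ∀ c, g x c ≠ M := fun x hx c h => hXM x hx (h ▸ hg₁ x c)
  have pencil_card : ∀ c ∈ M, (univ.filter fun ℓ : L => c ∈ ℓ ∧ ℓ ≠ M).card =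
      ProjectivePlane.order P L := by
    intro c hc
    have : (univ.filter fun ℓ : L => c ∈ ℓ ∧ ℓ ≠ M) =
        (univ.filter fun ℓ : L => c ∈ ℓ).erase M := by
      ext ℓ; simp [and_comm]
    rw [this, card_erase_of_mem (by simpa using hc), card_filter_line_mem]
    rfl
  have maps : ∀ c, ∀ x ∈ X, g x c ∈ univ.filter fun ℓ : L => c ∈ ℓ ∧ ℓ ≠ M := by
    intro c x hx
    simp [hg₂, hgM x hx]
  have card_le : X.card ≤ ProjectivePlane.order P L := by
    rw [← pencil_card w hw]
    refine card_le_card_of_injOn (fun x => g x w) (maps w) ?_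
    intro x hx y hy hxy
    exact hX x hx y hy (g x w) (hg₂ x w) (hg₁ x w)
      (by rw [show g x w = g y w from hxy]; exact hg₁ y w)
  have surj : ∀ c ∈ M, c ≠ w → c ≠ a → c ≠ b →
      ∀ ℓ ∈ univ.filter (fun ℓ : L => c ∈ ℓ ∧ ℓ ≠ M), ∃ x, ∃ _ : x ∈ X, g x c = ℓ := by
    intro c hc hcw hca hcb ℓ hℓ
    simp only [mem_filter, mem_univ, true_and] at hℓ
    have avoid : ∀ d ∈ M, c ≠ d → d ∉ ℓ := fun d hd hcd hdℓ =>
      (Nondegenerate.eq_or_eq hc hd hℓ.1 hdℓ).elim hcd fun h => hℓ.2 h.symm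
    obtain ⟨x, hx, hxℓ⟩ := hmeet ℓ (avoid w hw hcw) (avoid a ha hca) (avoid b hb hcb)
    refine ⟨x, hx, ?_⟩
    rcases Nondegenerate.eq_or_eq (hg₁ x c) (hg₂ x c) hxℓ hℓ.1 with h | h
    · exact absurd hc (h ▸ hXM x hx)
    · exact h
  have inj : ∀ c ∈ M, c ≠ w → c ≠ a → c ≠ b →
      ∀ x ∈ X, ∀ y ∈ X, g x c = g y c → x = y := by
    intro c hc hcw hca hcb x hx y hy hxy
    exact inj_on_of_surj_on_of_card_le (fun x _ => g x c) (fun x hx => maps c x hx)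
      (fun ℓ hℓ => by
        obtain ⟨x, hx, h⟩ := surj c hc hcw hca hcb ℓ hℓ
        exact ⟨x, hx, h⟩) (by rw [pencil_card c hc]; exact card_le) hx hy hxy
  have card_eq : X.card = ProjectivePlane.order P L := by
    obtain ⟨c, hc, hc'⟩ := exists_mem_notMem_of_card_lt_card
      (s := ({w, a, b} : Finset P)) (t := univ.filter fun x : P => x ∈ M)
      (by rw [card_filter_mem_line]; exact lt_of_le_of_lt card_le_three (by omega))
    simp only [mem_filter, mem_univ, true_and, mem_insert, mem_singleton, not_or] at hc hc'
    refine le_antisymm card_le ?_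
    rw [← pencil_card c hc]
    refine card_le_card_of_surjOn (fun x => g x c) ?_
    intro ℓ hℓ
    obtain ⟨x, hx, h⟩ := surj c hc hc'.1 hc'.2.1 hc'.2.2 ℓ hℓ
    exact ⟨x, hx, h⟩
  have collinear : ∀ x ∈ X, ∀ y ∈ X, g x a = g y a ∨ g x b = g y b := by
    intro x hx y hy
    by_cases hxy : x = y
    · simp [hxy]
    obtain ⟨c, hcM, hcℓ⟩ := exists_point_on_both P (hgM x hx y).symm
    have hline : ∀ z ∈ X, z ∈ g x y → g z c = g x y := by
      intro z hz hzℓ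
      rcases Nondegenerate.eq_or_eq (hg₁ z c) (hg₂ z c) hzℓ hcℓ with h | h
      · exact absurd hcM (h ▸ hXM z hz)
      · exact h
    have hxc := (hline x hx (hg₁ x y)).trans (hline y hy (hg₂ x y)).symm
    by_cases hca : c = a
    · exact .inl (hca ▸ hxc)
    by_cases hcb : c = b
    · exact .inr (hcb ▸ hxc)
    by_cases hcw : c = w
    · exact absurd (hX x hx y hy _ (hcw ▸ hcℓ) (hg₁ x y) (hg₂ x y)) hxy
    exact absurd (inj c hcM hcw hca hcb x hx y hy hxc) hxy
  obtain ⟨x₀, hx₀⟩ : X.Nonempty := card_pos.1 (by omega)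
  have pencil : ∃ c, (c = a ∨ c = b) ∧ ∀ x ∈ X, g x c = g x₀ c := by
    by_cases h : ∀ x ∈ X, g x a = g x₀ a
    · exact ⟨a, .inl rfl, h⟩
    · push Not at h
      obtain ⟨y, hy, hya⟩ := h
      refine ⟨b, .inr rfl, fun x hx => ?_⟩
      have h₁ := collinear x hx x₀ hx₀
      have h₂ := collinear x hx y hy
      have h₃ := collinear y hy x₀ hx₀
      grind
  obtain ⟨c, hc, hall⟩ := pencil
  have hcM : c ∈ M := by rcases hc with rfl | rfl <;> assumption
  refine ⟨g x₀ c, hgM x₀ hx₀ c, c, hc, hg₂ x₀ c, ?_⟩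
  have hsub : X ⊆ (univ.filter fun x : P => x ∈ g x₀ c).erase c := by
    intro x hx
    simp only [mem_erase, mem_filter, mem_univ, true_and]
    exact ⟨fun h => hXM x hx (h ▸ hcM), hall x hx ▸ hg₁ x c⟩
  have hEq := eq_of_subset_of_card_le hsub (by
    rw [card_erase_of_mem (by simpa using hg₂ x₀ c), card_filter_mem_line, card_eq]; simp)
  intro x hx hxc
  rw [hEq]
  simp [hx, hxc]

/-- A set with at most one point on each line through `w` that meets every line avoiding `w` and
`a` contains a line avoiding `w`, possibly except for its point `a`. -/
lemma exists_line_subset_of_meets (hq : 3 ≤ ProjectivePlane.order P L) {M : L} {w a : P}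
    (hw : w ∈ M) (ha : a ∈ M) (haw : a ≠ w) (A : Set P) (hwA : w ∉ A)
    (hA : ∀ x ∈ A, ∀ y ∈ A, ∀ ℓ : L, w ∈ ℓ → x ∈ ℓ → y ∈ ℓ → x = y)
    (hmeet : ∀ ℓ : L, w ∉ ℓ → a ∉ ℓ → ∃ x ∈ A, x ∈ ℓ) :
    ∃ ℓ : L, w ∉ ℓ ∧ ((∀ x ∈ ℓ, x ∈ A) ∨ a ∈ ℓ ∧ ∀ x ∈ ℓ, x ≠ a → x ∈ A) := by
  obtain ⟨b, hb, hbA, hrest⟩ : ∃ b, b ∈ M ∧ (b = a ∨ b ∈ A) ∧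
      ∀ x ∈ A, x ∈ M → x = a ∨ x = b := by
    by_cases h : ∃ b ∈ A, b ∈ M
    · obtain ⟨b, hbA, hb⟩ := h
      exact ⟨b, hb, .inr hbA, fun x hx hxM => .inr (hA x hx b hbA M hw hxM hb)⟩
    · exact ⟨a, ha, .inl rfl, fun x hx hxM => absurd ⟨x, hx, hxM⟩ h⟩
  obtain ⟨ℓ, hℓM, c, hc, hcℓ, hsub⟩ := exists_line_erase_eq hq hw ha hb
    (univ.filter fun x => x ∈ A ∧ x ∉ M) (by simp)
    (by
      intro x hx y hy
      simp only [mem_filter, mem_univ, true_and] at hx hy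
      exact hA x hx.1 y hy.1)
    (by
      intro ℓ h₁ h₂ h₃
      obtain ⟨x, hx, hxℓ⟩ := hmeet ℓ h₁ h₂
      refine ⟨x, ?_, hxℓ⟩
      simp only [mem_filter, mem_univ, true_and]
      refine ⟨hx, fun hxM => ?_⟩
      rcases hrest x hx hxM with rfl | rfl
      · exact h₂ hxℓ
      · exact h₃ hxℓ)
  have hcM : c ∈ M := by rcases hc with rfl | rfl <;> assumption
  have hcw : c ≠ w := by
    rcases hc with rfl | rfl
    · exact haw
    · rcases hbA with rfl | h
      · exact haw
      · rintro rfl; exact hwA h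
  refine ⟨ℓ, fun hwℓ => (Nondegenerate.eq_or_eq hcℓ hwℓ hcM hw).elim hcw hℓM, ?_⟩
  have hsub' : ∀ x ∈ ℓ, x ≠ c → x ∈ A := fun x hx hxc => by
    have := hsub x hx hxc
    simp only [mem_filter, mem_univ, true_and] at this
    exact this.1
  by_cases hca : c = a
  · subst hca; exact .inr ⟨hcℓ, hsub'⟩
  · left
    have hcA : c ∈ A := by
      rcases hc with rfl | rfl
      · exact absurd rfl hca
      · exact hbA.resolve_left hca
    intro x hx
    by_cases hxc : x = c
    · exact hxc ▸ hcA
    · exact hsub' x hx hxc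

/-- The plane-geometric core: a transversal `A` that, together with the new vertices indexed by
`J`, covers the construction must contain one of its edges. -/
lemma exists_edge_subset_of_cover (hq : 3 ≤ ProjectivePlane.order P L) {ι : Type*} [Nontrivial ι]
    {w : P} (m : ι → L) (s : ι → P) (f : ι → L) (k : L)
    (hm : ∀ i, w ∈ m i) (hsw : ∀ i, s i ≠ w) (hsm : ∀ i, s i ∈ m i)
    (hk : ∀ x, x ∈ k ↔ ∃ i, s i = x)
    (hwf : ∀ i, w ∉ f i) (hsf : ∀ i, s i ∈ f i) (hfk : ∀ i, f i ≠ k)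
    (A : Set P) (J : Set ι) (hwA : w ∉ A) (hJ : J.Subsingleton)
    (hA : ∀ x ∈ A, ∀ y ∈ A, ∀ ℓ : L, w ∈ ℓ → x ∈ ℓ → y ∈ ℓ → x = y)
    (h₁ : ∀ ℓ : L, w ∉ ℓ → ℓ ≠ k → ∀ i, s i ∈ ℓ → i ∈ J ∨ ∃ a ∈ A, a ∈ ℓ)
    (h₂ : ∀ i, ∃ a ∈ A, a ∈ f i)
    (h₃ : ∀ i, i ∈ J ∨ ∃ a ∈ A, a ∈ f i ∧ a ≠ s i) :
    (∃ i, ∀ x ∈ f i, x ∈ A) ∨ (∃ i ∈ J, ∀ x ∈ f i, x ≠ s i → x ∈ A) ∨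
      ∃ ℓ : L, w ∉ ℓ ∧ ℓ ≠ k ∧ ∃ i ∈ J, s i ∈ ℓ ∧ ∀ x ∈ ℓ, x ∈ A := by
  obtain ⟨j, hj⟩ : ∃ j, ∀ i ∈ J, i = j := by
    rcases J.eq_empty_or_nonempty with h | ⟨j, hj⟩
    · obtain ⟨j, -⟩ := exists_pair_ne ι
      exact ⟨j, by simp [h]⟩
    · exact ⟨j, fun i hi => hJ hi hj⟩
  have hsk : ∀ i, s i ∈ k := fun i => (hk _).2 ⟨i, rfl⟩
  have hwk : w ∉ k := fun h => by
    obtain ⟨i, hi⟩ := (hk w).1 h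
    exact hsw i hi
  have meets_k : ∀ ℓ : L, ∃ i, s i ∈ ℓ := by
    intro ℓ
    by_cases h : ℓ = k
    · exact ⟨j, h ▸ hsk j⟩
    · obtain ⟨x, hx, hxk⟩ := exists_point_on_both P h
      obtain ⟨i, rfl⟩ := (hk x).1 hxk
      exact ⟨i, hx⟩
  have full : ∀ ℓ : L, w ∉ ℓ → (∀ x ∈ ℓ, x ∈ A) →
      (∃ i, ∀ x ∈ f i, x ∈ A) ∨ ∃ ℓ : L, w ∉ ℓ ∧ ℓ ≠ k ∧ ∃ i ∈ J, s i ∈ ℓ ∧ ∀ x ∈ ℓ, x ∈ A := by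
    intro ℓ hwℓ hℓ
    have hAℓ : ∀ a ∈ A, a ∈ ℓ := by
      intro a ha
      obtain ⟨n, hwn, han⟩ := exists_line_through L w a
      obtain ⟨x, hxn, hxℓ⟩ := exists_point_on_both P (show n ≠ ℓ by rintro rfl; exact hwℓ hwn)
      exact hA a ha x (hℓ x hxℓ) n hwn han hxn ▸ hxℓ
    have step : ∀ i, i ∉ J → s i ∈ ℓ → ℓ = f i := by
      intro i hi hiℓ
      obtain ⟨a, ha, haf, hne⟩ := (h₃ i).resolve_left hi
      exact (Nondegenerate.eq_or_eq (hAℓ a ha) hiℓ haf (hsf i)).resolve_left hne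
    by_cases hℓk : ℓ = k
    · subst hℓk
      obtain ⟨i, hi⟩ := exists_ne j
      exact absurd (step i (fun h => hi (hj i h)) (hsk i)).symm (hfk i)
    · obtain ⟨i, hi⟩ := meets_k ℓ
      by_cases hiJ : i ∈ J
      · exact .inr ⟨ℓ, hwℓ, hℓk, i, hiJ, hi, hℓ⟩
      · exact .inl ⟨i, step i hiJ hi ▸ hℓ⟩
  obtain ⟨ℓ, hwℓ, hℓ | ⟨hjℓ, hℓ⟩⟩ := exists_line_subset_of_meets hq (hm j) (hsm j) (hsw j) A hwA hA
    (fun ℓ hwℓ hjℓ => by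
      obtain ⟨i, hi⟩ := meets_k ℓ
      refine (h₁ ℓ hwℓ (by rintro rfl; exact hjℓ (hsk j)) i hi).resolve_left fun hiJ => ?_
      exact hjℓ (hj i hiJ ▸ hi))
  · rcases full ℓ hwℓ hℓ with h | h
    · exact .inl h
    · exact .inr (.inr h)
  by_cases hjA : s j ∈ A
  · have : ∀ x ∈ ℓ, x ∈ A := fun x hx => by
      by_cases hxj : x = s j
      · exact hxj ▸ hjA
      · exact hℓ x hx hxj
    rcases full ℓ hwℓ this with h | h
    · exact .inl h
    · exact .inr (.inr h)
  have hAℓ : ∀ a ∈ A, a ∈ ℓ ∨ a ∈ m j := by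
    intro a ha
    obtain ⟨n, hwn, han⟩ := exists_line_through L w a
    obtain ⟨x, hxn, hxℓ⟩ := exists_point_on_both P (show n ≠ ℓ by rintro rfl; exact hwℓ hwn)
    by_cases hxj : x = s j
    · subst hxj
      exact .inr ((Nondegenerate.eq_or_eq hxn hwn (hsm j) (hm j)).resolve_left (hsw j) ▸ han)
    · exact .inl (hA a ha x (hℓ x hxℓ hxj) n hwn han hxn ▸ hxℓ)
  have through : ∀ n : L, s j ∈ n → (∃ a ∈ A, a ∈ n) → n = ℓ ∨ n = m j := by
    rintro n hn ⟨a, ha, han⟩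
    have hne : a ≠ s j := by rintro rfl; exact hjA ha
    rcases hAℓ a ha with h | h
    · exact .inl ((Nondegenerate.eq_or_eq han hn h hjℓ).resolve_left hne)
    · exact .inr ((Nondegenerate.eq_or_eq han hn h (hsm j)).resolve_left hne)
  have hfj : f j = ℓ := (through (f j) (hsf j) (h₂ j)).resolve_right
    fun h => hwf j (h ▸ hm j)
  by_cases hjJ : j ∈ J
  · exact .inr (.inl ⟨j, hjJ, by rw [hfj]; exact hℓ⟩)
  · exfalso
    obtain ⟨n, hn, hn'⟩ := exists_mem_notMem_of_card_lt_card
      (s := ({k, ℓ, m j} : Finset L)) (t := univ.filter fun n : L => s j ∈ n)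
      (by rw [card_filter_line_mem]; exact lt_of_le_of_lt card_le_three (by omega))
    simp only [mem_filter, mem_univ, true_and, mem_insert, mem_singleton, not_or] at hn hn'
    have hwn : w ∉ n := fun h => hn'.2.2
      ((Nondegenerate.eq_or_eq hn h (hsm j) (hm j)).resolve_left (hsw j))
    exact (through n hn ((h₁ n hwn hn'.1 j hn).resolve_left hjJ)).elim hn'.2.1 hn'.2.2

end Plane

section Transfer

lemma mem_linePoints {P L : Type*} [Membership P L] [Fintype P] {w : P} {ℓ : L}
    {p : {p : P // p ≠ w}} : p ∈ linePoints w ℓ ↔ (p : P) ∈ ℓ := by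
  simp [linePoints]

lemma card_linePoints {P L : Type*} [Membership P L] [Fintype P] [Fintype L]
    [Configuration.ProjectivePlane P L] {w : P} {ℓ : L} (h : w ∉ ℓ) :
    (linePoints w ℓ).card = ProjectivePlane.order P L + 1 := by
  rw [← card_filter_mem_line ℓ, ← card_map (Function.Embedding.subtype _)]
  congr 1
  ext x
  simp only [mem_map, mem_linePoints, Function.Embedding.subtype_apply, mem_filter, mem_univ,
    true_and]
  exact ⟨fun ⟨y, hy, hyx⟩ => hyx ▸ hy, fun hx => ⟨⟨x, fun hxw => h (hxw ▸ hx)⟩, hx, rfl⟩⟩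

lemma mem_hatE {V : Type*} {r : ℕ} {E : Finset V} {i : Fin r} {v : V ⊕ Fin r} :
    v ∈ hatE E i ↔ v = Sum.inr i ∨ ∃ x ∈ E, Sum.inl x = v := by
  simp [hatE]

lemma card_hatE {V : Type*} {r : ℕ} (E : Finset V) (i : Fin r) :
    (hatE E i).card = E.card + 1 := by
  rw [hatE, card_insert_of_notMem (by simp), card_image_of_injective _ Sum.inl_injective]

lemma Partite.card_le {V : Type*} {n : ℕ} {H : Set (Finset V)} {sides : Fin n → Set V}
    (h : Partite H sides) {e : Finset V} (he : e ∈ H) : e.card ≤ n := by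
  choose c hc using fun v => (h.1 v).exists
  calc e.card ≤ (univ : Finset (Fin n)).card :=
        card_le_card_of_injOn c (by simp) fun x hx y hy hxy =>
          h.2 e he (c x) x hx y hy (hc x) (by rw [show c x = c y from hxy]; exact hc y)
    _ = n := by simp

lemma eq_insert_of_subset_of_card_le {V : Type*} {e E : Finset V} {r : ℕ} (hsub : e ⊆ E)
    (hne : E ≠ e) (he : e.card = r) (hE : E.card ≤ r + 1) :
    E.card = r + 1 ∧ ∃ v, E = insert v e := by
  have hlt : e.card < E.card := card_lt_card (hsub.ssubset_of_ne hne.symm)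
  obtain ⟨v, hv, hve⟩ := exists_mem_notMem_of_card_lt_card hlt
  refine ⟨by omega, v, (eq_of_subset_of_card_le (insert_subset hv hsub) ?_).symm⟩
  rw [card_insert_of_notMem hve]
  omega

end Transfer

theorem statement_8 {P L : Type*} [Membership P L] [Fintype P] [Fintype L]
    [Configuration.ProjectivePlane P L] {r : ℕ} (hr : 5 ≤ r)
    (horder : Configuration.ProjectivePlane.order P L = r - 1) (w : P)
    (m : Fin r → L) (hm : EnumeratesLinesThrough w m)
    (s : Fin r → {p : P // p ≠ w}) (hside : ∀ i, ((s i : P) ∈ m i))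
    (hS : Finset.univ.image s ∈ truncatedPP P L w)
    (F : Fin r → Finset {p : P // p ≠ w})
    (hF : ∀ i, F i ∈ truncatedPP P L w)
    (hSF : ∀ i, Finset.univ.image s ∩ F i = {s i})
    {W' : Type*} (ι : ({p : P // p ≠ w} ⊕ Fin r) ↪ W')
    (G : Set (Finset W')) (sides' : Fin (r + 1) → Set W')
    (hGint : Intersecting G) (hGpart : Partite G sides')
    (hsub : ∀ e ∈ constructionH (truncatedPP P L w) (Finset.univ.image s) s F,
      e.image ι ∈ G)
    (hrestrict : ∀ j : Fin (r + 1),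
      sides' j ∩ Set.range ι = ι '' extSides (ppSide w m) j) :
    ∀ E ∈ G,
      (∀ e ∈ constructionH (truncatedPP P L w) (Finset.univ.image s) s F,
        E ≠ e.image ι) →
      E.card = r + 1 ∧ ∃ (i : Fin r) (v : W'),
        E = insert v (((F i).image Sum.inl).image ι) ∨
        E = insert v ((hatE ((F i).erase (s i)) i).image ι) := by
  intro E hE hEH
  obtain ⟨k, hwk, hk⟩ := hS
  choose f hwf hFf using hF
  have : Nontrivial (Fin r) := Fin.nontrivial_iff_two_le.2 (by omega)
  have hcardr : ProjectivePlane.order P L + 1 = r := by omega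
  have hs : Function.Injective fun i => (s i : P) := by
    intro i j hij
    by_contra hne
    have hij' : (s i : P) = s j := hij
    refine (Nondegenerate.eq_or_eq (hside i) (hm.2.1 i) (hij' ▸ hside j) (hm.2.1 j)).elim
      (s i).2 fun h => hne (hm.1 h)
  have hsk : ∀ i, (s i : P) ∈ k := fun i => by
    rw [← mem_linePoints, ← hk]; exact mem_image_of_mem _ (mem_univ i)
  have hk' : ∀ x, x ∈ k ↔ ∃ i, (s i : P) = x := by
    intro x
    constructor
    · intro hx
      have : (⟨x, fun h => hwk (h ▸ hx)⟩ : {p : P // p ≠ w}) ∈ linePoints w k :=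
        mem_linePoints.2 hx
      rw [← hk] at this
      obtain ⟨i, -, hi⟩ := mem_image.1 this
      exact ⟨i, congrArg Subtype.val hi⟩
    · rintro ⟨i, rfl⟩; exact hsk i
  have hsF : ∀ i, s i ∈ F i := fun i =>
    (mem_inter.1 (by rw [hSF i]; exact mem_singleton_self _ : s i ∈ univ.image s ∩ F i)).2
  have hsf : ∀ i, (s i : P) ∈ f i := fun i => by
    rw [← mem_linePoints, ← hFf]; exact hsF i
  have hfk : ∀ i, f i ≠ k := by
    intro i h
    obtain ⟨j, hj⟩ := exists_ne i
    have : s j ∈ univ.image s ∩ F i := mem_inter.2 ⟨mem_image_of_mem _ (mem_univ j), by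
      rw [hFf, mem_linePoints, h]; exact hsk j⟩
    rw [hSF i, mem_singleton] at this
    exact hj (hs (congrArg Subtype.val this))
  have hne_S : ∀ ℓ : L, ℓ ≠ k → linePoints w ℓ ≠ univ.image s := by
    intro ℓ hℓ h
    obtain ⟨i, j, hij⟩ := exists_pair_ne (Fin r)
    have hmem : ∀ i, (s i : P) ∈ ℓ := fun i => by
      rw [← mem_linePoints, h]; exact mem_image_of_mem _ (mem_univ i)
    exact (Nondegenerate.eq_or_eq (hmem i) (hmem j) (hsk i) (hsk j)).elim
      (fun h => hij (hs h)) hℓ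
  have hside_old : ∀ (i : Fin r) (x : {p : P // p ≠ w}), (x : P) ∈ m i →
      ι (Sum.inl x) ∈ sides' i.castSucc := by
    intro i x hx
    have : ι (Sum.inl x) ∈ ι '' extSides (ppSide w m) i.castSucc := by
      refine ⟨_, ?_, rfl⟩
      rw [extSides, Fin.lastCases_castSucc]
      exact ⟨x, hx, rfl⟩
    rw [← hrestrict] at this
    exact this.1
  have hside_new : ∀ i : Fin r, ι (Sum.inr i) ∈ sides' (Fin.last r) := by
    intro i
    have : ι (Sum.inr i) ∈ ι '' extSides (ppSide w m) (Fin.last r) := by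
      refine ⟨_, ?_, rfl⟩
      rw [extSides, Fin.lastCases_last]
      exact ⟨i, rfl⟩
    rw [← hrestrict] at this
    exact this.1
  have hcover : ∀ e ∈ constructionH (truncatedPP P L w) (univ.image s) s F,
      ∃ v ∈ e, ι v ∈ E := by
    intro e he
    obtain ⟨v, hvE, hv⟩ := hGint E hE _ (hsub e he)
    obtain ⟨u, hu, rfl⟩ := mem_image.1 hv
    exact ⟨u, hu, hvE⟩
  have hcoverHat : ∀ (D : Finset {p : P // p ≠ w}) (i : Fin r),
      hatE D i ∈ constructionH (truncatedPP P L w) (univ.image s) s F →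
      ι (Sum.inr i) ∈ E ∨ ∃ x ∈ D, ι (Sum.inl x) ∈ E := by
    intro D i hD
    obtain ⟨v, hv, hvE⟩ := hcover _ hD
    rcases mem_hatE.1 hv with rfl | ⟨x, hx, rfl⟩
    · exact .inl hvE
    · exact .inr ⟨x, hx, hvE⟩
  have hedge : ∀ ℓ : L, w ∉ ℓ → ℓ ≠ k → ∀ i, (s i : P) ∈ ℓ →
      hatE (linePoints w ℓ) i ∈ constructionH (truncatedPP P L w) (univ.image s) s F :=
    fun ℓ hwℓ hℓ i hi =>
      .inl (.inl ⟨_, ⟨ℓ, hwℓ, rfl⟩, hne_S ℓ hℓ, i, mem_linePoints.2 hi, rfl⟩)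
  have hedgeF : ∀ i, (F i).image Sum.inl ∈
      constructionH (truncatedPP P L w) (univ.image s) s F := fun i => .inl (.inr ⟨i, by congr!⟩)
  have hedgeF' : ∀ i, hatE ((F i).erase (s i)) i ∈
      constructionH (truncatedPP P L w) (univ.image s) s F := fun i => .inr ⟨i, by congr!⟩
  have hcard := hGpart.card_le hE
  have hFcard : ∀ i, (F i).card = r := fun i => by
    rw [hFf, card_linePoints (hwf i), hcardr]
  have key := exists_edge_subset_of_cover (by omega) m (fun i => (s i : P)) f k hm.2.1
    (fun i => (s i).2) hside hk' hwf hsf hfk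
    {x | ∃ h : x ≠ w, ι (Sum.inl ⟨x, h⟩) ∈ E} {i | ι (Sum.inr i) ∈ E}
    (fun ⟨h, _⟩ => h rfl)
    (fun i hi j hj => Sum.inr_injective (ι.injective
      (hGpart.2 E hE _ _ hi _ hj (hside_new i) (hside_new j))))
    (by
      rintro x ⟨hxw, hx⟩ y ⟨hyw, hy⟩ ℓ hwℓ hxℓ hyℓ
      obtain ⟨i, rfl⟩ := hm.2.2 ℓ hwℓ
      have := hGpart.2 E hE _ _ hx _ hy (hside_old i ⟨x, hxw⟩ hxℓ) (hside_old i ⟨y, hyw⟩ hyℓ)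
      exact congrArg Subtype.val (Sum.inl_injective (ι.injective this)))
    (by
      intro ℓ hwℓ hℓ i hi
      rcases hcoverHat _ i (hedge ℓ hwℓ hℓ i hi) with h | ⟨x, hx, hxE⟩
      · exact .inl h
      · exact .inr ⟨x, ⟨x.2, hxE⟩, mem_linePoints.1 hx⟩)
    (by
      intro i
      obtain ⟨v, hv, hvE⟩ := hcover _ (hedgeF i)
      obtain ⟨x, hx, rfl⟩ := mem_image.1 hv
      rw [hFf, mem_linePoints] at hx
      exact ⟨x, ⟨x.2, hvE⟩, hx⟩)
    (by
      intro i
      rcases hcoverHat _ i (hedgeF' i) with h | ⟨x, hx, hxE⟩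
      · exact .inl h
      · rw [mem_erase, hFf, mem_linePoints] at hx
        exact .inr ⟨x, ⟨x.2, hxE⟩, hx.2, fun h => hx.1 (Subtype.ext h)⟩)
  have hsubHat : ∀ (D : Finset {p : P // p ≠ w}) (i : Fin r), ι (Sum.inr i) ∈ E →
      (∀ x ∈ D, ι (Sum.inl x) ∈ E) → (hatE D i).image ι ⊆ E := by
    intro D i hi hD v hv
    obtain ⟨u, hu, rfl⟩ := mem_image.1 hv
    rcases mem_hatE.1 hu with rfl | ⟨x, hx, rfl⟩
    · exact hi
    · exact hD x hx
  rcases key with ⟨i, hi⟩ | ⟨i, hiE, hi⟩ | ⟨ℓ, hwℓ, hℓ, i, hiE, hiℓ, hi⟩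
  · have hsubE : ((F i).image Sum.inl).image ι ⊆ E := by
      intro v hv
      obtain ⟨u, hu, rfl⟩ := mem_image.1 hv
      obtain ⟨x, hx, rfl⟩ := mem_image.1 hu
      rw [hFf, mem_linePoints] at hx
      exact (hi x hx).2
    obtain ⟨h, v, hv⟩ := eq_insert_of_subset_of_card_le hsubE (hEH _ (hedgeF i)) (by
      rw [card_image_of_injective _ ι.injective, card_image_of_injective _ Sum.inl_injective,
        hFcard]) hcard
    exact ⟨h, i, v, .inl hv⟩
  · have hsubE := hsubHat ((F i).erase (s i)) i hiE (by
      intro x hx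
      rw [mem_erase, hFf, mem_linePoints] at hx
      exact (hi x hx.2 fun h => hx.1 (Subtype.ext h)).2)
    obtain ⟨h, v, hv⟩ := eq_insert_of_subset_of_card_le hsubE (hEH _ (hedgeF' i)) (by
      rw [card_image_of_injective _ ι.injective, card_hatE, card_erase_of_mem (hsF i), hFcard]
      omega) hcard
    exact ⟨h, i, v, .inr hv⟩
  · have hsubE := hsubHat (linePoints w ℓ) i hiE fun x hx => (hi x (mem_linePoints.1 hx)).2
    refine absurd (eq_of_subset_of_card_le hsubE ?_).symm (hEH _ (hedge ℓ hwℓ hℓ i hiℓ))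
    rw [card_image_of_injective _ ι.injective, card_hatE, card_linePoints hwℓ, hcardr]
    exact hcard

end
end

section
/- For every δ with 0 < δ < 1/2 there exist infinitely many integers r with the following property: there exist at least exp(r^{1/2−δ}) hypergraphs, each on a countably infinite vertex set, each an r-partite r-uniform intersecting hypergraph with cover number r−1, each maximal in the sense that any r-partite r-uniform intersecting hypergraph with cover number r−1 containing an isomorphic copy of it as a subhypergraph is itself isomorphic to one of its subhypergraphs, and pairwise inequivalent in the sense that for no two of them does each contain an isomorphic copy of the other as a subhypergraph. -/
open Finset

noncomputable section
open scoped Classical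

open Configuration

/-- `H₁` has an isomorphic copy as a subhypergraph of `H₂` (both on vertex set `ℕ`). -/
def EmbedsIn (H₁ H₂ : Set (Finset ℕ)) : Prop :=
  ∃ φ : ℕ ≃ ℕ, ∀ e ∈ H₁, e.image φ ∈ H₂

lemma EmbedsIn.refl (H : Set (Finset ℕ)) : EmbedsIn H H :=
  ⟨Equiv.refl ℕ, fun e he => by simpa using he⟩

lemma EmbedsIn.trans {H₁ H₂ H₃ : Set (Finset ℕ)} (h₁ : EmbedsIn H₁ H₂) (h₂ : EmbedsIn H₂ H₃) :
    EmbedsIn H₁ H₃ := by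
  obtain ⟨φ, hφ⟩ := h₁
  obtain ⟨ψ, hψ⟩ := h₂
  refine ⟨φ.trans ψ, fun e he => ?_⟩
  simpa [Finset.image_image] using hψ _ (hφ e he)

lemma exists_inequivalent {α : Type*} (s : Setoid α) (S : Finset α) (B : ℕ)
    (hB : ∀ a ∈ S, ∀ T ⊆ S, (∀ b ∈ T, s a b) → T.card ≤ B) :
    ∃ (n : ℕ) (a : Fin n → α), S.card ≤ B * n ∧ (∀ k, a k ∈ S) ∧
      ∀ k l, k ≠ l → ¬ s (a k) (a l) := by
  set T := S.image (Quotient.mk s)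
  have hT : ∀ k : Fin T.card, ∃ a ∈ S, Quotient.mk s a = T.equivFin.symm k := fun k =>
    Finset.mem_image.mp (T.equivFin.symm k).2
  choose a haS ha using hT
  refine ⟨T.card, a, ?_, haS, fun k l hkl h => hkl ?_⟩
  · refine Finset.card_le_mul_card_image S B fun c hc => ?_
    obtain ⟨b, hb, rfl⟩ := Finset.mem_image.mp hc
    refine hB b hb _ (Finset.filter_subset _ _) fun b' hb' => ?_
    exact Quotient.exact (Finset.mem_filter.mp hb').2.symm
  · have : Quotient.mk s (a k) = Quotient.mk s (a l) := Quotient.sound h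
    rw [ha, ha] at this
    exact T.equivFin.symm.injective (Subtype.ext this)

section Plane

variable {K : Type*} [Field K]

/-- The intercept of the point `y` in the parallel class `d`; the lines of the class `d` in the
affine plane `K × K` are the level sets of `intercept d`. -/
def intercept (d : Option K) (y : K × K) : K :=
  d.elim y.1 fun t => y.2 - t * y.1

/-- The parallel class of the line joining the origin to `y`. -/
def direction (y : K × K) : Option K :=
  if y.1 = 0 then none else some (y.2 / y.1)

lemma intercept_zero (d : Option K) : intercept d 0 = 0 := by
  cases d <;> simp [intercept]

lemma intercept_sub (d : Option K) (y z : K × K) :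
    intercept d (y - z) = intercept d y - intercept d z := by
  cases d
  · simp [intercept]
  · simp only [intercept, Option.elim_some, Prod.fst_sub, Prod.snd_sub]
    ring

lemma intercept_direction (y : K × K) : intercept (direction y) y = 0 := by
  unfold direction
  split_ifs with h
  · simpa [intercept] using h
  · simp [intercept, h]

lemma exists_intercept_eq {d e : Option K} (hde : d ≠ e) (a b : K) :
    ∃ y : K × K, intercept d y = a ∧ intercept e y = b := by
  match d, e with
  | none, none => exact absurd rfl hde
  | none, some t => exact ⟨(a, b + t * a), by simp [intercept]⟩
  | some s, none => exact ⟨(b, a + s * b), by simp [intercept]⟩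
  | some s, some t =>
    have hst : s - t ≠ 0 := sub_ne_zero.mpr fun h => hde (by rw [h])
    refine ⟨((b - a) / (s - t), a + s * ((b - a) / (s - t))), by simp [intercept], ?_⟩
    simp only [intercept, Option.elim_some]
    field_simp
    ring

lemma eq_zero_of_intercept {d e : Option K} (hde : d ≠ e) {y : K × K}
    (hd : intercept d y = 0) (he : intercept e y = 0) : y = 0 := by
  match d, e with
  | none, none => exact absurd rfl hde
  | none, some t =>
    simp only [intercept, Option.elim_none, Option.elim_some] at hd he
    rw [hd, mul_zero, sub_zero] at he
    exact Prod.ext hd he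
  | some s, none =>
    simp only [intercept, Option.elim_none, Option.elim_some] at hd he
    rw [he, mul_zero, sub_zero] at hd
    exact Prod.ext he hd
  | some s, some t =>
    simp only [intercept, Option.elim_some] at hd he
    have hst : s - t ≠ 0 := sub_ne_zero.mpr fun h => hde (by rw [h])
    have h : (s - t) * y.1 = 0 := by linear_combination he - hd
    have h1 : y.1 = 0 := (mul_eq_zero.mp h).resolve_left hst
    rw [h1, mul_zero, sub_zero] at hd
    exact Prod.ext h1 hd

lemma eq_of_intercept_eq {d e : Option K} (hde : d ≠ e) {y z : K × K}
    (hd : intercept d y = intercept d z) (he : intercept e y = intercept e z) : y = z :=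
  sub_eq_zero.mp (eq_zero_of_intercept hde (by rw [intercept_sub, hd, sub_self])
    (by rw [intercept_sub, he, sub_self]))

lemma eq_direction {d : Option K} {y : K × K} (hy : y ≠ 0) (h : intercept d y = 0) :
    d = direction y := by
  by_contra hd
  exact hy (eq_zero_of_intercept hd h (intercept_direction y))

lemma intercept_direction_sub (y z : K × K) :
    intercept (direction (y - z)) y = intercept (direction (y - z)) z := by
  have := intercept_direction (y - z)
  rwa [intercept_sub, sub_eq_zero] at this

/-- A choice of a nonzero point on each line through the origin, such that no line contains all of
the chosen points which do not lie on its parallel through the origin. -/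
structure IsMarking (f : Option K → K × K) : Prop where
  ne_zero : ∀ d, f d ≠ 0
  intercept_self : ∀ d, intercept d (f d) = 0
  exists_ne : ∀ e c, ∃ d ≠ e, intercept e (f d) ≠ c

lemma IsMarking.direction_eq {f : Option K → K × K} (hf : IsMarking f) (d : Option K) :
    direction (f d) = d :=
  (eq_direction (hf.ne_zero d) (hf.intercept_self d)).symm

lemma IsMarking.eq_of_intercept {f : Option K → K × K} (hf : IsMarking f) {d e : Option K}
    (h : intercept e (f d) = 0) : e = d :=
  (eq_direction (hf.ne_zero d) h).trans (hf.direction_eq d)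

/-- The edge of a point `y ≠ 0`: it selects the line through `y` from each parallel class, and the
second copy of the line joining `y` to the origin from the additional side `none`. The values
`Sum.inr n` are vertices which lie on no line. -/
def pencil (y : K × K) : Option (Option K) → Option K ⊕ ℕ
  | none => Sum.inl (direction y)
  | some d => Sum.inl (some (intercept d y))

/-- The hypergraph of a marking, each edge being given by its vertex in each side. -/
def family (f : Option K → K × K) : Set (Option (Option K) → Option K ⊕ ℕ) :=
  {h | (∃ y ≠ 0, h = pencil y) ∨
    ∃ d i, (i = none ∨ i = some d) ∧ ∀ j ≠ i, h j = pencil (f d) j}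

lemma pencil_mem_family (f : Option K → K × K) {y : K × K} (hy : y ≠ 0) :
    pencil y ∈ family f :=
  Or.inl ⟨y, hy, rfl⟩

lemma update_pencil_mem_family (f : Option K → K × K) {d : Option K} {i : Option (Option K)}
    (hi : i = none ∨ i = some d) (w : Option K ⊕ ℕ) :
    Function.update (pencil (f d)) i w ∈ family f :=
  Or.inr ⟨d, i, hi, fun _ hj => Function.update_of_ne hj _ _⟩

lemma exists_point_of_mem_family {f : Option K → K × K} (hf : IsMarking f)
    {h : Option (Option K) → Option K ⊕ ℕ} (hh : h ∈ family f) :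
    ∃ y ≠ 0, ∃ i, (i = none ∨ i = some (direction y)) ∧ (∀ j ≠ i, h j = pencil y j) ∧
      (h = pencil y ∨ y = f (direction y)) := by
  rcases hh with ⟨y, hy, rfl⟩ | ⟨d, i, hi, hd⟩
  · exact ⟨y, hy, none, Or.inl rfl, fun _ _ => rfl, Or.inl rfl⟩
  · exact ⟨f d, hf.ne_zero d, i, by rwa [hf.direction_eq], hd, Or.inr (by rw [hf.direction_eq])⟩

lemma exists_agree_pencil {h : Option (Option K) → Option K ⊕ ℕ}
    {y z : K × K} {i : Option (Option K)} (hyz : direction y = direction z)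
    (hi : i = none ∨ i = some (direction z)) (hz : ∀ j ≠ i, h j = pencil z j) :
    ∃ j, pencil y j = h j := by
  rcases hi with rfl | rfl
  · refine ⟨some (direction z), ?_⟩
    rw [hz _ (by simp)]
    simp only [pencil]
    rw [intercept_direction, ← hyz, intercept_direction]
  · refine ⟨none, ?_⟩
    rw [hz _ (by simp)]
    simp only [pencil]
    rw [hyz]

lemma exists_agree {f : Option K → K × K} (hf : IsMarking f)
    {h h' : Option (Option K) → Option K ⊕ ℕ} (hh : h ∈ family f) (hh' : h' ∈ family f) :
    ∃ j, h j = h' j := by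
  obtain ⟨y, hy0, i, hi, hy, hy'⟩ := exists_point_of_mem_family hf hh
  obtain ⟨z, hz0, k, hk, hz, hz'⟩ := exists_point_of_mem_family hf hh'
  by_cases hd : direction y = direction z
  · rcases hy' with rfl | hy'
    · exact exists_agree_pencil hd hk hz
    rcases hz' with rfl | hz'
    · obtain ⟨j, hj⟩ := exists_agree_pencil hd.symm hi hy
      exact ⟨j, hj.symm⟩
    have hyz : y = z := by rw [hy', hz', hd]
    subst hyz
    obtain ⟨e, he⟩ := exists_ne (direction y)
    have aux : ∀ l : Option (Option K), (l = none ∨ l = some (direction y)) → some e ≠ l := by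
      rintro l (rfl | rfl)
      · simp
      · simpa using he
    exact ⟨some e, by rw [hy _ (aux _ hi), hz _ (aux _ hk)]⟩
  · have hyz := intercept_direction_sub y z
    generalize direction (y - z) = e at hyz
    have hey : e ≠ direction y := by
      rintro rfl
      rw [intercept_direction] at hyz
      exact hd (eq_direction hz0 hyz.symm)
    have hez : e ≠ direction z := by
      rintro rfl
      rw [intercept_direction] at hyz
      exact hd (eq_direction hy0 hyz).symm
    refine ⟨some e, ?_⟩
    rw [hy _ (by rcases hi with rfl | rfl <;> simp [hey]),
      hz _ (by rcases hk with rfl | rfl <;> simp [hez])]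
    simp only [pencil]
    rw [hyz]

lemma exists_injective_line (d : Option K) (c : K) :
    ∃ P : K → K × K, Function.Injective P ∧ (∀ b, intercept d (P b) = c) ∧
      ∀ y, intercept d y = c → ∃ b, P b = y := by
  obtain ⟨e, he⟩ := exists_ne d
  choose P hP using fun b => exists_intercept_eq he.symm c b
  refine ⟨P, fun a b hab => ?_, fun b => (hP b).1, fun y hy => ⟨intercept e y, ?_⟩⟩
  · rw [← (hP a).2, ← (hP b).2, hab]
  · exact eq_of_intercept_eq he.symm ((hP _).1.trans hy.symm) (hP _).2

lemma eq_of_pencil_eq {d : Option K} {c : K} (hc : c ≠ 0) {y z : K × K}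
    (hy : intercept d y = c) (hz : intercept d z = c) {i : Option (Option K)} (hi : i ≠ some d)
    (h : pencil y i = pencil z i) : y = z := by
  match i with
  | none =>
    simp only [pencil, Sum.inl.injEq] at h
    refine eq_of_intercept_eq (d := d) (e := direction y) ?_ (hy.trans hz.symm) ?_
    · rintro rfl
      exact hc (hy.symm.trans (intercept_direction y))
    · rw [intercept_direction, h, intercept_direction]
  | some e =>
    simp only [pencil, Sum.inl.injEq, Option.some.injEq] at h
    exact eq_of_intercept_eq (fun hde => hi (by rw [hde])) (hy.trans hz.symm) h

variable [Fintype K]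

/-- A small cover which misses a line not through the origin consists of the vertices of the edges
of the points of this line. -/
lemma exists_pencil_of_mem_cover {f : Option K → K × K}
    {C : Finset (Option (Option K) × (Option K ⊕ ℕ))} (hC : ∀ h ∈ family f, ∃ i, (i, h i) ∈ C)
    (hcard : C.card ≤ Fintype.card K) {d : Option K} {c : K} (hc : c ≠ 0)
    (hdc : (some d, Sum.inl (some c)) ∉ C) {v : Option (Option K) × (Option K ⊕ ℕ)} (hv : v ∈ C) :
    v.1 ≠ some d ∧ v ≠ (none, Sum.inl d) := by
  obtain ⟨P, hinj, hP, -⟩ := exists_injective_line d c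
  have hP0 : ∀ b, P b ≠ 0 := fun b hb => hc (by rw [← hP b, hb, intercept_zero])
  choose m hm using fun b => hC _ (pencil_mem_family f (hP0 b))
  have hmd : ∀ b, m b ≠ some d := fun b hb => hdc (by simpa [hb, pencil, hP] using hm b)
  have hminj : Function.Injective fun b => (m b, pencil (P b) (m b)) := by
    intro a b hab
    obtain ⟨h1, h2⟩ := Prod.mk.inj hab
    rw [← h1] at h2
    exact hinj (eq_of_pencil_eq hc (hP a) (hP b) (hmd a) h2)
  have himage : univ.image (fun b => (m b, pencil (P b) (m b))) = C := by
    refine Finset.eq_of_subset_of_card_le (fun v hv => ?_) ?_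
    · obtain ⟨b, -, rfl⟩ := Finset.mem_image.mp hv
      exact hm b
    · rw [Finset.card_image_of_injective _ hminj]
      exact hcard
  rw [← himage] at hv
  obtain ⟨b, -, rfl⟩ := Finset.mem_image.mp hv
  refine ⟨hmd b, fun hb => ?_⟩
  obtain ⟨h1, h2⟩ := Prod.mk.inj hb
  rw [h1] at h2
  simp only [pencil, Sum.inl.injEq] at h2
  exact hc (by rw [← hP b, ← h2, intercept_direction])

lemma card_lt_of_cover {f : Option K → K × K} (hf : IsMarking f) (hK : 3 ≤ Fintype.card K)
    {C : Finset (Option (Option K) × (Option K ⊕ ℕ))} (hC : ∀ h ∈ family f, ∃ i, (i, h i) ∈ C) :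
    Fintype.card K < C.card := by
  by_contra! hcard
  have hmiss : ∀ {d : Option K} {c : K}, c ≠ 0 → (some d, Sum.inl (some c)) ∉ C →
      ∀ {v}, v ∈ C → v.1 ≠ some d ∧ v ≠ (none, Sum.inl d) :=
    fun hc hdc _ hv => exists_pencil_of_mem_cover hC hcard hc hdc hv
  obtain ⟨d, hd⟩ : ∃ d, ∀ c ≠ 0, (some d, Sum.inl (some c)) ∈ C := by
    by_contra! hall
    obtain ⟨i, hi⟩ := hC _ (pencil_mem_family f (y := (1, 0)) (by simp))
    match i with
    | none =>
      obtain ⟨c, hc, hdc⟩ := hall (direction (1, 0))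
      exact (hmiss hc hdc hi).2 rfl
    | some e =>
      obtain ⟨c, hc, hdc⟩ := hall e
      exact (hmiss hc hdc hi).1 rfl
  have hother : ∀ e ≠ d, ∃ c ≠ 0, (some e, Sum.inl (some c)) ∉ C := by
    intro e hed
    by_contra! he
    have hsub : (({d, e} : Finset (Option K)) ×ˢ (univ.erase (0 : K))).image
        (fun x => ((some x.1, Sum.inl (some x.2)) : Option (Option K) × (Option K ⊕ ℕ))) ⊆ C := by
      intro v hv
      obtain ⟨⟨a, c⟩, hx, rfl⟩ := Finset.mem_image.mp hv
      simp only [Finset.mem_product, Finset.mem_insert, Finset.mem_singleton, Finset.mem_erase,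
        Finset.mem_univ, and_true] at hx
      rcases hx with ⟨rfl | rfl, hc⟩
      · exact hd c hc
      · exact he c hc
    have hle := Finset.card_le_card hsub
    rw [Finset.card_image_of_injective, Finset.card_product, Finset.card_pair hed.symm,
      Finset.card_erase_of_mem (Finset.mem_univ _), Finset.card_univ] at hle
    · omega
    · rintro ⟨a, c⟩ ⟨a', c'⟩ h
      simpa using h
  have hC' : ∀ v ∈ C, v.1 = some d ∨ v.1 = none ∧ ∀ e ≠ d, v.2 ≠ Sum.inl e := by
    rintro ⟨i, w⟩ hv
    match i with
    | none =>
      refine Or.inr ⟨rfl, ?_⟩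
      rintro e hed rfl
      obtain ⟨c, hc, hec⟩ := hother e hed
      exact (hmiss hc hec hv).2 rfl
    | some e =>
      left
      by_contra hed
      obtain ⟨c, hc, hec⟩ := hother e fun h => hed (by rw [h])
      exact (hmiss hc hec hv).1 rfl
  obtain ⟨n, hn⟩ := Infinite.exists_notMem_finset (C.image fun v => v.2.elim (fun _ => 0) id)
  have hn' : ∀ i, (i, Sum.inr n) ∉ C := fun i hi => hn (Finset.mem_image.mpr ⟨_, hi, rfl⟩)
  have hline : (some d, Sum.inl (some 0)) ∈ C := by
    obtain ⟨j, hj⟩ := hC _ (update_pencil_mem_family f (d := d) (Or.inl rfl) (Sum.inr n))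
    have hj0 : j ≠ none := by
      rintro rfl
      simp only [Function.update_self] at hj
      exact hn' _ hj
    rw [Function.update_of_ne hj0] at hj
    rcases hC' _ hj with h | h
    · obtain rfl : j = some d := h
      simpa [pencil, hf.intercept_self] using hj
    · exact absurd h.1 hj0
  have hcopy : (none, Sum.inl d) ∈ C := by
    obtain ⟨j, hj⟩ := hC _ (update_pencil_mem_family f (d := d) (Or.inr rfl) (Sum.inr n))
    have hj0 : j ≠ some d := by
      rintro rfl
      simp only [Function.update_self] at hj
      exact hn' _ hj
    rw [Function.update_of_ne hj0] at hj
    rcases hC' _ hj with h | h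
    · exact absurd h hj0
    · obtain rfl : j = none := h.1
      simpa [pencil, hf.direction_eq] using hj
  have hsub : insert (none, Sum.inl d) (univ.image
      fun c : K => ((some d, Sum.inl (some c)) : Option (Option K) × (Option K ⊕ ℕ))) ⊆ C := by
    intro v hv
    rcases Finset.mem_insert.mp hv with rfl | hv
    · exact hcopy
    · obtain ⟨c, -, rfl⟩ := Finset.mem_image.mp hv
      by_cases hc : c = 0
      · rwa [hc]
      · exact hd c hc
  have hle := Finset.card_le_card hsub
  rw [Finset.card_insert_of_notMem (by simp), Finset.card_image_of_injective _
    (fun a b h => by simpa using h), Finset.card_univ] at hle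
  omega

omit [Fintype K] in
lemma exists_agree_ne_none {f : Option K → K × K} (hf : IsMarking f) (d : Option K)
    {h : Option (Option K) → Option K ⊕ ℕ} (hh : h ∈ family f) :
    ∃ e : Option K, h (some e) = pencil (f d) (some e) := by
  obtain ⟨w, hw⟩ := exists_ne (h none)
  obtain ⟨j, hj⟩ := exists_agree hf hh (update_pencil_mem_family f (d := d) (Or.inl rfl) w)
  match j with
  | none =>
    rw [Function.update_self] at hj
    exact absurd hj.symm hw
  | some e => exact ⟨e, by rwa [Function.update_of_ne (by simp)] at hj⟩

omit [Fintype K] in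
lemma eq_mark_of_agree_update {f : Option K → K × K} (hf : IsMarking f)
    {h : Option (Option K) → Option K ⊕ ℕ} {y : K × K} {d : Option K} {i : Option (Option K)}
    {w : Option K ⊕ ℕ} (hy : intercept d y = 0)
    (hh : ∀ e ≠ d, h (some e) = pencil y (some e))
    (hi : Function.update (pencil (f d)) i w (some d) ≠ h (some d))
    (hi' : Function.update (pencil (f d)) i w none ≠ h none)
    (hid : i = none ∨ i = some d)
    (hagree : ∃ j, h j = Function.update (pencil (f d)) i w j) : y = f d := by
  obtain ⟨j, hj⟩ := hagree
  match j with
  | none => exact absurd hj.symm hi'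
  | some e =>
    by_cases hed : e = d
    · subst hed
      exact absurd hj.symm hi
    rw [Function.update_of_ne (by rcases hid with rfl | rfl <;> simp [hed]), hh e hed] at hj
    simp only [pencil, Sum.inl.injEq, Option.some.injEq] at hj
    exact eq_of_intercept_eq hed hj (hy.trans (hf.intercept_self d).symm)

/-- The lines of a transversal `h` meeting all edges, other than the one of the class `e`, meet
each line of the class `e` bijectively, with the exception of two such lines. -/
lemma exists_intercept_of_agree {f : Option K → K × K} {h : Option (Option K) → Option K ⊕ ℕ}
    (hh : ∀ h' ∈ family f, ∃ i, h i = h' i) {e : Option K} (he : ∀ d, h none = Sum.inl d → d = e)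
    {c : K} (hc : c ≠ 0) (hec : h (some e) ≠ Sum.inl (some c)) :
    (∀ d ≠ e, ∃ y, intercept e y = c ∧ h (some d) = pencil y (some d)) ∧
    ∀ y, intercept e y = c → ∀ d ≠ e, ∀ d' ≠ e, h (some d) = pencil y (some d) →
      h (some d') = pencil y (some d') → d = d' := by
  obtain ⟨P, hinj, hP, hPsurj⟩ := exists_injective_line e c
  have hP0 : ∀ b, P b ≠ 0 := fun b hb => hc (by rw [← hP b, hb, intercept_zero])
  have key : ∀ b, ∃ d ≠ e, h (some d) = pencil (P b) (some d) := by
    intro b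
    obtain ⟨i, hi⟩ := hh _ (pencil_mem_family f (hP0 b))
    match i with
    | none =>
      have := he _ hi
      exact absurd ((hP b).symm.trans (by rw [← this, intercept_direction])) hc
    | some d =>
      refine ⟨d, ?_, hi⟩
      rintro rfl
      exact hec (by rw [hi, pencil, hP])
  choose m hme hm using key
  have huniq : ∀ {a b : K} {d}, d ≠ e → h (some d) = pencil (P a) (some d) →
      h (some d) = pencil (P b) (some d) → a = b := by
    intro a b d hde ha hb
    exact hinj (eq_of_pencil_eq hc (hP a) (hP b) (by simpa using hde) (ha.symm.trans hb))
  have hminj : Function.Injective m := fun a b hab =>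
    huniq (hme a) (hm a) (by rw [hab]; exact hm b)
  have himage : univ.image m = univ.erase e := by
    refine Finset.eq_of_subset_of_card_le (fun d hd => ?_) ?_
    · obtain ⟨b, -, rfl⟩ := Finset.mem_image.mp hd
      exact Finset.mem_erase.mpr ⟨hme b, Finset.mem_univ _⟩
    · rw [Finset.card_image_of_injective _ hminj, Finset.card_erase_of_mem (Finset.mem_univ _)]
      simp [Fintype.card_option]
  have hsurj : ∀ d ≠ e, ∃ b, m b = d := by
    intro d hd
    have : d ∈ univ.image m := by simpa [himage] using hd
    simpa using this
  refine ⟨fun d hd => ?_, fun y hy d hd d' hd' h1 h2 => ?_⟩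
  · obtain ⟨b, rfl⟩ := hsurj d hd
    exact ⟨P b, hP b, hm b⟩
  · obtain ⟨b, rfl⟩ := hPsurj y hy
    obtain ⟨a, rfl⟩ := hsurj d hd
    obtain ⟨a', rfl⟩ := hsurj d' hd'
    rw [huniq hd (hm a) h1, huniq hd' (hm a') h2]

omit [Field K] in
lemma exists_ne_ne (hK : 3 ≤ Fintype.card K) (a b : K) : ∃ c, c ≠ a ∧ c ≠ b := by
  have : ({a, b} : Finset K).card < Fintype.card K := (Finset.card_le_two).trans_lt hK
  obtain ⟨c, -, hc⟩ := Finset.exists_mem_notMem_of_card_lt_card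
    (s := {a, b}) (t := Finset.univ) (by rwa [Finset.card_univ])
  exact ⟨c, by simpa using hc⟩

lemma exists_concurrent_of_agree {f : Option K → K × K} (hK : 3 ≤ Fintype.card K)
    {h : Option (Option K) → Option K ⊕ ℕ}
    (hh : ∀ h' ∈ family f, ∃ i, h i = h' i) {e : Option K}
    (he : ∀ d, h none = Sum.inl d → d = e) :
    ∃ y, (∀ d ≠ e, h (some d) = pencil y (some d)) ∧
      (intercept e y = 0 ∨ h (some e) = pencil y (some e)) := by
  obtain ⟨a, ha, ha'⟩ : ∃ a : K, (∀ c, h (some e) = Sum.inl (some c) → c = a) ∧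
      (a = 0 ∨ h (some e) = Sum.inl (some a)) := by
    by_cases hx : ∃ c, h (some e) = Sum.inl (some c)
    · obtain ⟨c, hc⟩ := hx
      exact ⟨c, fun c' hc' => by simpa [hc] using hc'.symm, Or.inr hc⟩
    · exact ⟨0, fun c hc => absurd ⟨c, hc⟩ hx, Or.inl rfl⟩
  have hval : ∀ d ≠ e, ∃ b, h (some d) = Sum.inl (some b) := by
    obtain ⟨c, hc, hca⟩ := exists_ne_ne hK 0 a
    intro d hd
    obtain ⟨y, -, hy⟩ :=
      (exists_intercept_of_agree hh he hc fun hec => hca (ha c hec)).1 d hd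
    exact ⟨_, hy⟩
  have hmeet : ∀ d ≠ e, ∀ d' ≠ e, d ≠ d' → ∃ z, h (some d) = pencil z (some d) ∧
      h (some d') = pencil z (some d') ∧ (intercept e z = 0 ∨ intercept e z = a) := by
    intro d hd d' hd' hne
    obtain ⟨b, hb⟩ := hval d hd
    obtain ⟨b', hb'⟩ := hval d' hd'
    obtain ⟨z, rfl, rfl⟩ := exists_intercept_eq hne b b'
    refine ⟨z, hb, hb', ?_⟩
    by_contra! hz
    exact hne ((exists_intercept_of_agree hh he hz.1 fun hec => hz.2 (ha _ hec)).2 z rfl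
      d hd d' hd' hb hb')
  have huniq : ∀ {d}, d ≠ e → ∀ {y z}, h (some d) = pencil y (some d) →
      h (some d) = pencil z (some d) → intercept e y = intercept e z → y = z := by
    intro d hd y z hy hz hyz
    have hyz' := hy.symm.trans hz
    simp only [pencil, Sum.inl.injEq, Option.some.injEq] at hyz'
    exact eq_of_intercept_eq hd hyz' hyz
  obtain ⟨d₁, hd₁⟩ := exists_ne e
  obtain ⟨b, hb⟩ := hval d₁ hd₁
  obtain ⟨y, hy, hye⟩ := exists_intercept_eq hd₁ b 0
  obtain ⟨z, hz, hze⟩ := exists_intercept_eq hd₁ b a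
  have hy₁ : h (some d₁) = pencil y (some d₁) := by rw [hb, pencil, hy]
  have hz₁ : h (some d₁) = pencil z (some d₁) := by rw [hb, pencil, hz]
  by_cases hally : ∀ d ≠ e, h (some d) = pencil y (some d)
  · exact ⟨y, hally, Or.inl hye⟩
  by_cases hallz : ∀ d ≠ e, h (some d) = pencil z (some d)
  · refine ⟨z, hallz, ha'.imp (fun h0 => hze.trans h0) fun h0 => ?_⟩
    rw [h0, pencil, hze]
  push Not at hally hallz
  obtain ⟨d, hd, hdy⟩ := hally
  obtain ⟨d', hd', hdz⟩ := hallz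
  have hdz' : h (some d) = pencil z (some d) := by
    obtain ⟨u, hu, hu₁, hu0 | hua⟩ := hmeet d hd d₁ hd₁ (by rintro rfl; exact hdy hy₁)
    · rw [huniq hd₁ hu₁ hy₁ (hu0.trans hye.symm)] at hu
      exact absurd hu hdy
    · rwa [huniq hd₁ hu₁ hz₁ (hua.trans hze.symm)] at hu
  have hdy' : h (some d') = pencil y (some d') := by
    obtain ⟨u, hu, hu₁, hu0 | hua⟩ := hmeet d' hd' d₁ hd₁ (by rintro rfl; exact hdz hz₁)
    · rwa [huniq hd₁ hu₁ hy₁ (hu0.trans hye.symm)] at hu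
    · rw [huniq hd₁ hu₁ hz₁ (hua.trans hze.symm)] at hu
      exact absurd hu hdz
  obtain ⟨u, hu, hu', hu0 | hua⟩ := hmeet d hd d' hd' (by rintro rfl; exact hdz hdz')
  · rw [huniq hd' hu' hdy' (hu0.trans hye.symm)] at hu
    exact absurd hu hdy
  · rw [huniq hd hu hdz' (hua.trans hze.symm)] at hu'
    exact absurd hu' hdz

/-- Every transversal which meets all edges is an edge. -/
lemma mem_family_of_agree {f : Option K → K × K} (hf : IsMarking f) (hK : 3 ≤ Fintype.card K)
    {h : Option (Option K) → Option K ⊕ ℕ} (hh : ∀ h' ∈ family f, ∃ i, h i = h' i) :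
    h ∈ family f := by
  obtain ⟨e, he⟩ : ∃ e, ∀ d, h none = Sum.inl d → d = e := by
    by_cases hx : ∃ d, h none = Sum.inl d
    · obtain ⟨d, hd⟩ := hx
      exact ⟨d, fun d' hd' => by simpa [hd] using hd'.symm⟩
    · exact ⟨none, fun d hd => absurd ⟨d, hd⟩ hx⟩
  obtain ⟨y, hy, hye⟩ := exists_concurrent_of_agree hK hh he
  have hmark : ∀ d i w, (i = none ∨ i = some d) →
      ∃ j, h j = Function.update (pencil (f d)) i w j :=
    fun d i w hi => hh _ (update_pencil_mem_family f hi w)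
  by_cases hy0 : y = 0
  · subst hy0
    have hline : ∀ d ≠ e, h (some e) = Sum.inl (some (intercept e (f d))) := by
      intro d hd
      obtain ⟨j, hj⟩ := hmark d (some d) (Sum.inr 0) (Or.inr rfl)
      match j with
      | none =>
        rw [Function.update_of_ne (by simp)] at hj
        exact absurd (he d (by rw [hj, pencil, hf.direction_eq])) hd
      | some d' =>
        by_cases hdd : d' = d
        · subst hdd
          rw [Function.update_self, hy _ hd] at hj
          simp [pencil] at hj
        rw [Function.update_of_ne (by simpa using hdd)] at hj
        by_cases hde : d' = e
        · rwa [hde] at hj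
        rw [hy _ hde] at hj
        simp only [pencil, intercept_zero, Sum.inl.injEq, Option.some.injEq] at hj
        exact absurd (hf.eq_of_intercept hj.symm) hdd
    obtain ⟨d, hd, -⟩ := hf.exists_ne e 0
    obtain ⟨d', hd', hne⟩ := hf.exists_ne e (intercept e (f d))
    have := (hline d' hd').symm.trans (hline d hd)
    simp only [Sum.inl.injEq, Option.some.injEq] at this
    exact absurd this hne
  by_cases hall : ∀ d, h (some d) = pencil y (some d)
  · by_cases hnone : h none = Sum.inl (direction y)
    · left
      refine ⟨y, hy0, funext fun i => ?_⟩
      match i with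
      | none => exact hnone
      | some d => exact hall d
    · have hyf : y = f (direction y) :=
        eq_mark_of_agree_update hf (intercept_direction y) (fun d _ => hall d)
          (by rw [Function.update_self, hall]; simp [pencil])
          (by rw [Function.update_of_ne (by simp), pencil, hf.direction_eq]; exact Ne.symm hnone)
          (Or.inr rfl) (hmark _ _ (Sum.inr 0) (Or.inr rfl))
      refine Or.inr ⟨direction y, none, Or.inl rfl, fun j hj => ?_⟩
      rw [← hyf]
      match j with
      | none => exact absurd rfl hj
      | some d => exact hall d
  have hed : h (some e) ≠ pencil y (some e) := by
    intro h0
    refine hall fun d => ?_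
    by_cases hd : d = e
    · rw [hd, h0]
    · exact hy d hd
  have hye0 : intercept e y = 0 := hye.resolve_right hed
  rw [pencil, hye0] at hed
  have hnone : h none = Sum.inl e := by
    by_contra hne
    obtain ⟨e', he'⟩ := exists_ne e
    obtain ⟨b, hb0, hb⟩ := exists_ne_ne hK 0 (intercept e' y)
    obtain ⟨z, hz, hze⟩ := exists_intercept_eq he' b 0
    have hz0 : z ≠ 0 := fun h0 => hb0 (by rw [← hz, h0, intercept_zero])
    obtain ⟨i, hi⟩ := hh _ (pencil_mem_family f hz0)
    match i with
    | none =>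
      rw [pencil, ← eq_direction hz0 hze] at hi
      exact hne hi
    | some d =>
      by_cases hd : d = e
      · subst hd
        rw [pencil, hze] at hi
        exact hed hi
      · rw [hy d hd] at hi
        simp only [pencil, Sum.inl.injEq, Option.some.injEq] at hi
        have hyz := eq_of_intercept_eq hd hi (hye0.trans hze.symm)
        exact hb (by rw [← hz, hyz])
  have hyf : y = f e :=
    eq_mark_of_agree_update hf hye0 hy
      (by rw [Function.update_of_ne (by simp), pencil, hf.intercept_self]; exact Ne.symm hed)
      (by rw [Function.update_self, hnone]; simp)
      (Or.inl rfl) (hmark _ _ (Sum.inr 0) (Or.inl rfl))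
  refine Or.inr ⟨e, some e, Or.inr rfl, fun j hj => ?_⟩
  rw [← hyf]
  match j with
  | none => rw [hnone, pencil, ← eq_direction hy0 hye0]
  | some d => exact hy d (by simpa using hj)

end Plane

section Transversal

variable {I W : Type*} [Fintype I]

/-- The edge with vertex `θ (i, h i)` in the side `i`. -/
def edgeOf (θ : I × W ≃ ℕ) (h : I → W) : Finset ℕ :=
  univ.image fun i => θ (i, h i)

lemma mem_edgeOf (θ : I × W ≃ ℕ) (h : I → W) (i : I) (w : W) :
    θ (i, w) ∈ edgeOf θ h ↔ h i = w := by
  simp only [edgeOf, Finset.mem_image, Finset.mem_univ, true_and, EmbeddingLike.apply_eq_iff_eq,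
    Prod.mk.injEq]
  exact ⟨fun ⟨j, hj, hw⟩ => hj ▸ hw, fun hw => ⟨i, rfl, hw⟩⟩

lemma card_edgeOf (θ : I × W ≃ ℕ) (h : I → W) : (edgeOf θ h).card = Fintype.card I := by
  have hinj : Function.Injective fun i => θ (i, h i) :=
    fun i j hij => congrArg Prod.fst (θ.injective hij)
  rw [edgeOf, Finset.card_image_of_injective _ hinj, Finset.card_univ]

lemma image_edgeOf (θ : I × W ≃ ℕ) (φ : ℕ ≃ ℕ) (h : I → W) :
    (edgeOf θ h).image φ = edgeOf (θ.trans φ) h := by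
  simp [edgeOf, Finset.image_image, Function.comp_def]

lemma exists_mem_edgeOf (θ : I × W ≃ ℕ) (h h' : I → W) :
    (∃ v, v ∈ edgeOf θ h ∧ v ∈ edgeOf θ h') ↔ ∃ i, h i = h' i := by
  constructor
  · rintro ⟨v, hv, hv'⟩
    obtain ⟨⟨i, w⟩, rfl⟩ := θ.surjective v
    rw [mem_edgeOf] at hv hv'
    exact ⟨i, hv.trans hv'.symm⟩
  · rintro ⟨i, hi⟩
    exact ⟨θ (i, h i), (mem_edgeOf _ _ _ _).mpr rfl, (mem_edgeOf _ _ _ _).mpr hi.symm⟩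

lemma eq_of_injective_of_agree {J : Type*} [Fintype J] (hIJ : Fintype.card I = Fintype.card J)
    {σ τ : I → J} (hσ : Function.Injective σ) (hτ : Function.Injective τ) {i : I}
    (h : ∀ j ≠ i, σ j = τ j) : σ i = τ i := by
  obtain ⟨j, hj⟩ := ((Fintype.bijective_iff_injective_and_card τ).mpr ⟨hτ, hIJ⟩).2 (σ i)
  by_cases hji : j = i
  · rw [← hj, hji]
  · exact absurd (hσ ((h j hji).trans hj)) hji

/-- Every edge of an `r`-partite `r`-uniform hypergraph is a transversal of the sides. -/
lemma exists_eq_edgeOf {r : ℕ} {ψ : I × W ≃ ℕ} {G : Set (Finset ℕ)} {sides : Fin r → Set ℕ}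
    (hG : Partite G sides) (hU : Uniform G r) (κ : I ≃ Fin r)
    (hκ : ∀ i w, ψ (i, w) ∈ sides (κ i)) {e : Finset ℕ} (he : e ∈ G) : ∃ h, e = edgeOf ψ h := by
  have hI : Fintype.card I = r := by simpa using Fintype.card_congr κ
  have hinj : Set.InjOn (fun v => (ψ.symm v).1) e := by
    intro v hv v' hv' hvv
    obtain ⟨⟨i, w⟩, rfl⟩ := ψ.surjective v
    obtain ⟨⟨i', w'⟩, rfl⟩ := ψ.surjective v'
    simp only [Equiv.symm_apply_apply] at hvv
    subst hvv
    exact hG.2 e he (κ i) _ hv _ hv' (hκ _ _) (hκ _ _)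
  have himage : e.image (fun v => (ψ.symm v).1) = univ := by
    refine Finset.eq_univ_of_card _ ?_
    rw [Finset.card_image_of_injOn hinj, hU e he, hI]
  have hsurj : ∀ i, ∃ w, ψ (i, w) ∈ e := by
    intro i
    obtain ⟨v, hv, hvi⟩ := Finset.mem_image.mp (himage ▸ Finset.mem_univ i)
    refine ⟨(ψ.symm v).2, ?_⟩
    rwa [← hvi, Prod.mk.eta, Equiv.apply_symm_apply]
  choose h hh using hsurj
  refine ⟨h, (Finset.eq_of_subset_of_card_le (fun v hv => ?_) ?_).symm⟩
  · obtain ⟨i, -, rfl⟩ := Finset.mem_image.mp hv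
    exact hh i
  · rw [hU e he, card_edgeOf, hI]

end Transversal

section Hypergraph

variable {K : Type*} [Field K] [Fintype K]

/-- The hypergraph of a marking, with the vertices numbered by `θ`. -/
def hypergraph (θ : Option (Option K) × (Option K ⊕ ℕ) ≃ ℕ) (f : Option K → K × K) :
    Set (Finset ℕ) :=
  edgeOf θ '' family f

/-- The sides of `hypergraph θ f`. -/
def hypergraphSides {r : ℕ} (θ : Option (Option K) × (Option K ⊕ ℕ) ≃ ℕ)
    (ι : Option (Option K) ≃ Fin r) (j : Fin r) : Set ℕ :=
  {v | ι (θ.symm v).1 = j}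

lemma partite_hypergraph {r : ℕ} (θ : Option (Option K) × (Option K ⊕ ℕ) ≃ ℕ)
    (f : Option K → K × K) (ι : Option (Option K) ≃ Fin r) :
    Partite (hypergraph θ f) (hypergraphSides θ ι) := by
  refine ⟨fun v => ⟨_, rfl, fun j hj => hj.symm⟩, ?_⟩
  rintro _ ⟨h, -, rfl⟩ j x hx y hy hxj hyj
  obtain ⟨⟨i, w⟩, rfl⟩ := θ.surjective x
  obtain ⟨⟨i', w'⟩, rfl⟩ := θ.surjective y
  rw [mem_edgeOf] at hx hy
  simp only [hypergraphSides, Equiv.symm_apply_apply, Set.mem_ofPred_eq] at hxj hyj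
  obtain rfl := ι.injective (hxj.trans hyj.symm)
  rw [← hx, ← hy]

lemma uniform_hypergraph {r : ℕ} (θ : Option (Option K) × (Option K ⊕ ℕ) ≃ ℕ)
    (f : Option K → K × K) (ι : Option (Option K) ≃ Fin r) : Uniform (hypergraph θ f) r := by
  rintro _ ⟨h, -, rfl⟩
  rw [card_edgeOf, Fintype.card_congr ι, Fintype.card_fin]

lemma intersecting_hypergraph (θ : Option (Option K) × (Option K ⊕ ℕ) ≃ ℕ)
    {f : Option K → K × K} (hf : IsMarking f) : Intersecting (hypergraph θ f) := by
  rintro _ ⟨h, hh, rfl⟩ _ ⟨h', hh', rfl⟩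
  exact (exists_mem_edgeOf θ h h').mpr (exists_agree hf hh hh')

lemma coverNumber_hypergraph (θ : Option (Option K) × (Option K ⊕ ℕ) ≃ ℕ)
    {f : Option K → K × K} (hf : IsMarking f) (hK : 3 ≤ Fintype.card K) :
    coverNumber (hypergraph θ f) = Fintype.card K + 1 := by
  have hmem : Fintype.card K + 1 ∈
      {n | ∃ C : Finset ℕ, IsCover (↑C) (hypergraph θ f) ∧ C.card = n} := by
    refine ⟨univ.image fun d => θ (some d, pencil (f none) (some d)), ?_, ?_⟩
    · rintro _ ⟨h, hh, rfl⟩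
      obtain ⟨d, hd⟩ := exists_agree_ne_none hf none hh
      exact ⟨θ (some d, pencil (f none) (some d)), by simp, (mem_edgeOf _ _ _ _).mpr hd⟩
    · rw [Finset.card_image_of_injective, Finset.card_univ, Fintype.card_option]
      intro a b hab
      simpa using congrArg Prod.fst (θ.injective hab)
  apply le_antisymm
  · exact Nat.sInf_le hmem
  · refine le_csInf ⟨_, hmem⟩ ?_
    rintro _ ⟨C, hC, rfl⟩
    have : Fintype.card K < (C.image θ.symm).card := by
      refine card_lt_of_cover hf hK fun h hh => ?_
      obtain ⟨v, hv, hvh⟩ := hC _ ⟨h, hh, rfl⟩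
      obtain ⟨⟨i, w⟩, rfl⟩ := θ.surjective v
      rw [mem_edgeOf] at hvh
      subst hvh
      exact ⟨i, Finset.mem_image.mpr ⟨_, hv, by simp⟩⟩
    rwa [Finset.card_image_of_injective _ θ.symm.injective] at this

/-- The sides of a hypergraph containing a copy of the hypergraph of a marking are determined. -/
lemma exists_side_equiv {r : ℕ} {f : Option K → K × K} (hf : IsMarking f)
    (hr : Fintype.card (Option (Option K)) = r)
    {ψ : Option (Option K) × (Option K ⊕ ℕ) ≃ ℕ} {G : Set (Finset ℕ)} {sides : Fin r → Set ℕ}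
    (hG : Partite G sides) (hsub : ∀ h ∈ family f, edgeOf ψ h ∈ G) :
    ∃ κ : Option (Option K) ≃ Fin r, ∀ i w, ψ (i, w) ∈ sides (κ i) := by
  choose col hcol hcol' using hG.1
  have hr' : Fintype.card (Option (Option K)) = Fintype.card (Fin r) := by rw [hr, Fintype.card_fin]
  have hinj : ∀ h ∈ family f, Function.Injective fun i => col (ψ (i, h i)) := by
    intro h hh i j hij
    have := hG.2 _ (hsub h hh) (col (ψ (i, h i))) _ ((mem_edgeOf ψ h i _).mpr rfl)
      _ ((mem_edgeOf ψ h j _).mpr rfl) (hcol _) (by simp only at hij; rw [hij]; exact hcol _)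
    simpa using congrArg Prod.fst (ψ.injective this)
  have hconst : ∀ i w w', col (ψ (i, w)) = col (ψ (i, w')) := by
    intro i w w'
    obtain ⟨d, hd⟩ : ∃ d, i = none ∨ i = some d := by
      cases i with
      | none => exact ⟨none, Or.inl rfl⟩
      | some d => exact ⟨d, Or.inr rfl⟩
    have := eq_of_injective_of_agree hr' (i := i)
      (hinj _ (update_pencil_mem_family f hd w)) (hinj _ (update_pencil_mem_family f hd w'))
      (fun j hj => by simp only [Function.update_of_ne hj])
    simpa using this
  refine ⟨Equiv.ofBijective (fun i => col (ψ (i, Sum.inr 0)))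
    ((Fintype.bijective_iff_injective_and_card _).mpr ⟨fun i j hij => ?_, hr'⟩), fun i w => ?_⟩
  · refine hinj _ (pencil_mem_family f (hf.ne_zero none)) ?_
    simp only
    rw [hconst i _ (Sum.inr 0), hconst j _ (Sum.inr 0)]
    exact hij
  · rw [Equiv.ofBijective_apply, hconst i _ w]
    exact hcol _

lemma exists_mem_family_of_mem {r : ℕ} {f : Option K → K × K} (hf : IsMarking f)
    (hK : 3 ≤ Fintype.card K) {ψ : Option (Option K) × (Option K ⊕ ℕ) ≃ ℕ} {G : Set (Finset ℕ)}
    {sides : Fin r → Set ℕ} (hG : Partite G sides) (hU : Uniform G r) (hI : Intersecting G)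
    (hsub : ∀ h ∈ family f, edgeOf ψ h ∈ G) (κ : Option (Option K) ≃ Fin r)
    (hκ : ∀ i w, ψ (i, w) ∈ sides (κ i)) {e : Finset ℕ} (he : e ∈ G) :
    ∃ h ∈ family f, e = edgeOf ψ h := by
  obtain ⟨h, rfl⟩ := exists_eq_edgeOf hG hU κ hκ he
  exact ⟨h, mem_family_of_agree hf hK fun h' hh' =>
    (exists_mem_edgeOf ψ h h').mp (hI _ he _ (hsub h' hh')), rfl⟩

lemma embedsIn_hypergraph {r : ℕ} {f : Option K → K × K} (hf : IsMarking f)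
    (hK : 3 ≤ Fintype.card K) (hr : Fintype.card (Option (Option K)) = r)
    (θ : Option (Option K) × (Option K ⊕ ℕ) ≃ ℕ) {G : Set (Finset ℕ)}
    {sides : Fin r → Set ℕ} (hG : Partite G sides) (hU : Uniform G r) (hI : Intersecting G)
    (hemb : EmbedsIn (hypergraph θ f) G) : EmbedsIn G (hypergraph θ f) := by
  obtain ⟨φ, hφ⟩ := hemb
  have hsub : ∀ h ∈ family f, edgeOf (θ.trans φ) h ∈ G := fun h hh => by
    rw [← image_edgeOf]
    exact hφ _ ⟨h, hh, rfl⟩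
  obtain ⟨κ, hκ⟩ := exists_side_equiv hf hr hG hsub
  refine ⟨φ.symm, fun e he => ?_⟩
  obtain ⟨h, hh, rfl⟩ := exists_mem_family_of_mem hf hK hG hU hI hsub κ hκ he
  refine ⟨h, hh, ?_⟩
  rw [image_edgeOf]
  congr 1
  ext
  simp

omit [Fintype K] in
lemma exists_mark_of_mem_family {f : Option K → K × K} {h : Option (Option K) → Option K ⊕ ℕ}
    (hh : h ∈ family f) {i : Option (Option K)} {n : ℕ} (hi : h i = Sum.inr n) :
    ∃ d, (i = none ∨ i = some d) ∧ ∀ j ≠ i, h j = pencil (f d) j := by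
  have hne : ∀ y : K × K, pencil y i ≠ Sum.inr n := by
    intro y
    cases i <;> simp [pencil]
  rcases hh with ⟨y, -, rfl⟩ | ⟨d, k, hk, hd⟩
  · exact absurd hi (hne y)
  · have hik : i = k := by
      by_contra hik
      exact hne (f d) (by rw [← hd i hik, hi])
    subst hik
    exact ⟨d, hk, hd⟩

omit [Fintype K] in
/-- The edges which can be changed in two sides are those of the points of the marking. -/
lemma eq_pencil_of_update_mem_family {f : Option K → K × K} (hf : IsMarking f)
    {h : Option (Option K) → Option K ⊕ ℕ} {i j : Option (Option K)} (hij : i ≠ j)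
    (hi : Function.update h i (Sum.inr 0) ∈ family f)
    (hj : Function.update h j (Sum.inr 0) ∈ family f) :
    ∃ d, h = pencil (f d) ∧ (i = none ∨ i = some d) ∧ (j = none ∨ j = some d) := by
  obtain ⟨d, hid, hd⟩ := exists_mark_of_mem_family hi (Function.update_self _ _ _)
  obtain ⟨d', hjd, hd'⟩ := exists_mark_of_mem_family hj (Function.update_self _ _ _)
  have hd : ∀ k ≠ i, h k = pencil (f d) k := fun k hk => by
    rw [← hd k hk, Function.update_of_ne hk]
  have hd' : ∀ k ≠ j, h k = pencil (f d') k := fun k hk => by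
    rw [← hd' k hk, Function.update_of_ne hk]
  have hboth : ∀ k ≠ i, k ≠ j → pencil (f d) k = pencil (f d') k := fun k hki hkj =>
    (hd k hki).symm.trans (hd' k hkj)
  have hdd : d = d' := by
    by_contra hdd
    rcases hid with rfl | rfl <;> rcases hjd with rfl | rfl
    · exact hij rfl
    · have := hboth (some d) (by simp) (by simpa using hdd)
      simp only [pencil, Sum.inl.injEq, Option.some.injEq, hf.intercept_self] at this
      exact hdd (hf.eq_of_intercept this.symm)
    · have := hboth (some d') (by simpa using Ne.symm hdd) (by simp)
      simp only [pencil, Sum.inl.injEq, Option.some.injEq, hf.intercept_self] at this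
      exact hdd (hf.eq_of_intercept this).symm
    · have := hboth none (by simp) (by simp)
      simp only [pencil, Sum.inl.injEq, hf.direction_eq] at this
      exact hdd this
  subst hdd
  refine ⟨d, funext fun k => ?_, hid, hjd⟩
  by_cases hk : k = i
  · exact hd' k fun hkj => hij (hk.symm.trans hkj)
  · exact hd k hk

/-- An embedding between the hypergraphs of two markings permutes the parallel classes and
respects the directions of the lines joining the points of the markings. -/
lemma exists_perm_of_embedsIn {f g : Option K → K × K} (hf : IsMarking f) (hg : IsMarking g)
    (θ : Option (Option K) × (Option K ⊕ ℕ) ≃ ℕ)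
    (hemb : EmbedsIn (hypergraph θ f) (hypergraph θ g)) :
    ∃ τ : Equiv.Perm (Option K), ∀ d d' e, intercept e (f d) = intercept e (f d') →
      intercept (τ e) (g (τ d)) = intercept (τ e) (g (τ d')) := by
  obtain ⟨φ, hφ⟩ := hemb
  have hsub : ∀ h ∈ family f, edgeOf (θ.trans φ) h ∈ hypergraph θ g := fun h hh => by
    rw [← image_edgeOf]
    exact hφ _ ⟨h, hh, rfl⟩
  obtain ⟨κ, hκ⟩ := exists_side_equiv hf rfl
    (partite_hypergraph θ g (Fintype.equivFin _)) hsub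
  set ψ := θ.trans φ
  set σ : Equiv.Perm (Option (Option K)) := κ.trans (Fintype.equivFin _).symm with hσ
  set ρ : Option (Option K) → (Option K ⊕ ℕ) → Option K ⊕ ℕ :=
    fun i w => (θ.symm (ψ (i, w))).2 with hρ
  have hψ : ∀ i w, ψ (i, w) = θ (σ i, ρ i w) := by
    intro i w
    have h1 : (θ.symm (ψ (i, w))).1 = σ i := (Equiv.eq_symm_apply _).mpr (hκ i w)
    rw [← h1, hρ, Prod.mk.eta, Equiv.apply_symm_apply]
  have hρsurj : ∀ i w, ∃ w', ρ i w' = w := by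
    intro i w
    obtain ⟨⟨i', w'⟩, hw'⟩ := ψ.surjective (θ (σ i, w))
    rw [hψ, θ.apply_eq_iff_eq, Prod.mk.injEq, σ.apply_eq_iff_eq] at hw'
    obtain ⟨rfl, hw'⟩ := hw'
    exact ⟨w', hw'⟩
  have hmap : ∀ h ∈ family f, ∀ h', (∀ i, h' (σ i) = ρ i (h i)) → h' ∈ family g := by
    intro h hh h' hh'
    obtain ⟨h'', hmem, heq⟩ := hsub h hh
    suffices h'' = h' by rwa [← this]
    funext j
    obtain ⟨i, rfl⟩ := σ.surjective j
    rw [hh', ← mem_edgeOf θ, heq, ← hψ, mem_edgeOf]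
  have hmark : ∀ d, ∃ d', (∀ i, pencil (g d') (σ i) = ρ i (pencil (f d) i)) ∧
      (σ none = none ∨ σ none = some d') ∧ (σ (some d) = none ∨ σ (some d) = some d') := by
    intro d
    have hfree : ∀ i, (i = none ∨ i = some d) → Function.update
        (fun j => ρ (σ.symm j) (pencil (f d) (σ.symm j))) (σ i) (Sum.inr 0) ∈ family g := by
      intro i hi
      obtain ⟨w, hw⟩ := hρsurj i (Sum.inr 0)
      refine hmap _ (update_pencil_mem_family f hi w) _ fun k => ?_
      by_cases hk : k = i
      · subst hk
        rw [Function.update_self, Function.update_self, hw]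
      · rw [Function.update_of_ne (by simpa using hk), Function.update_of_ne hk,
          Equiv.symm_apply_apply]
    obtain ⟨d', hd', h1, h2⟩ := eq_pencil_of_update_mem_family hg
      (σ.injective.ne (by simp)) (hfree none (Or.inl rfl)) (hfree (some d) (Or.inr rfl))
    exact ⟨d', fun i => by rw [← hd']; simp only [Equiv.symm_apply_apply], h1, h2⟩
  choose τ hτ hτ0 hτ1 using hmark
  have hσ0 : σ none = none := by
    by_contra h0
    obtain ⟨d, hd⟩ := exists_ne (none : Option K)
    have aux : ∀ d, σ (some d) = none := by
      intro d
      refine (hτ1 d).resolve_right fun h => ?_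
      have := σ.injective (h.trans ((hτ0 d).resolve_left h0).symm)
      simp at this
    have := σ.injective ((aux d).trans (aux none).symm)
    exact hd (by simpa using this)
  have hσ1 : ∀ d, σ (some d) = some (τ d) := by
    intro d
    refine (hτ1 d).resolve_left fun h => ?_
    have := σ.injective (h.trans hσ0.symm)
    simp at this
  have hτinj : Function.Injective τ := by
    intro d d' h
    have : σ (some d) = σ (some d') := by rw [hσ1, hσ1, h]
    simpa using this
  refine ⟨Equiv.ofBijective τ (Finite.injective_iff_bijective.mp hτinj), fun d d' e h => ?_⟩
  have h1 := hτ d (some e)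
  have h2 := hτ d' (some e)
  have h3 : pencil (f d) (some e) = pencil (f d') (some e) := by simp only [pencil, h]
  rw [h3, ← h2, hσ1] at h1
  simpa [pencil] using h1

lemma card_embedsIn_le {f : Option K → K × K} (hf : IsMarking f)
    (θ : Option (Option K) × (Option K ⊕ ℕ) ≃ ℕ) (S : Finset (Option K → K × K))
    (hS : ∀ g ∈ S, IsMarking g ∧ EmbedsIn (hypergraph θ f) (hypergraph θ g)) :
    S.card ≤ (Fintype.card K + 1).factorial * Fintype.card K ^ 2 := by
  choose! τ hτ using fun g hg => exists_perm_of_embedsIn hf (hS g hg).1 θ (hS g hg).2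
  calc S.card ≤ (univ : Finset (Equiv.Perm (Option K) × (K × K))).card := by
        refine Finset.card_le_card_of_injOn (fun g => (τ g, g (τ g none)))
          (fun _ _ => Finset.mem_coe.mpr (Finset.mem_univ _)) ?_
        intro g hg g' hg' heq
        obtain ⟨h1, h2⟩ := Prod.mk.inj heq
        have hg1 := hτ g hg
        have hg1' := hτ g' hg'
        rw [← h1] at h2 hg1'
        funext d
        obtain ⟨d, rfl⟩ := (τ g).surjective d
        by_cases hd : d = none
        · rw [hd, h2]
        have hdir := intercept_direction_sub (f d) (f none)
        generalize direction (f d - f none) = e at hdir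
        have hed : e ≠ d := by
          rintro rfl
          rw [hf.intercept_self] at hdir
          exact hd (hf.eq_of_intercept hdir.symm)
        refine eq_of_intercept_eq ((τ g).injective.ne hed) ?_ ?_
        · rw [hg1 _ _ _ hdir, hg1' _ _ _ hdir, h2]
        · rw [(hS g hg).1.intercept_self, (hS g' hg').1.intercept_self]
    _ = _ := by
        rw [Finset.card_univ, Fintype.card_prod, Fintype.card_perm, Fintype.card_option,
          Fintype.card_prod, sq]

/-- A point on the line of direction `d` through the origin, at the given scale. -/
def pointAt (d : Option K) (s : K) : K × K :=
  d.elim (0, s) fun t => (s, t * s)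

omit [Fintype K] in
lemma pointAt_eq_zero {d : Option K} {s : K} (h : pointAt d s = 0) : s = 0 := by
  cases d <;> simp_all [pointAt]

omit [Fintype K] in
lemma pointAt_injective (d : Option K) : Function.Injective (pointAt d) := by
  intro s t h
  cases d <;> simp_all [pointAt]

omit [Fintype K] in
lemma intercept_pointAt (d : Option K) (s : K) : intercept d (pointAt d s) = 0 := by
  cases d <;> simp [pointAt, intercept]

/-- The scales of a marking: `1`, `1`, `2` in the directions `0`, `1`, `2`, and arbitrary
otherwise. -/
def scaleOf (m : {d : Option K // d ∉ ({some 0, some 1, some 2} : Finset (Option K))} → Kˣ)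
    (d : Option K) : K :=
  if h : d ∉ ({some 0, some 1, some 2} : Finset (Option K)) then m ⟨d, h⟩
  else if d = some 2 then 2 else 1

omit [Fintype K] in
lemma isMarking_pointAt_scaleOf (h2 : (2 : K) ≠ 0) (h3 : (3 : K) ≠ 0)
    (m : {d : Option K // d ∉ ({some 0, some 1, some 2} : Finset (Option K))} → Kˣ) :
    IsMarking fun d => pointAt d (scaleOf m d) := by
  have h12 : (1 : K) ≠ 2 := fun h => one_ne_zero (α := K) (by linear_combination -h)
  have hf0 : pointAt (some 0) (scaleOf m (some 0)) = (1, 0) := by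
    simp [pointAt, scaleOf, h2.symm]
  have hf1 : pointAt (some 1) (scaleOf m (some 1)) = (1, 1) := by
    simp [pointAt, scaleOf, h12]
  have hf2 : pointAt (some 2) (scaleOf m (some 2)) = (2, 2 * 2) := by
    simp [pointAt, scaleOf]
  refine ⟨fun d hd => ?_, fun d => intercept_pointAt _ _, fun e c => ?_⟩
  · have := pointAt_eq_zero hd
    unfold scaleOf at this
    split_ifs at this
    · exact h2 this
    · exact one_ne_zero this
    · exact Units.ne_zero _ this
  · by_contra! h
    have H0 := h (some 0)
    have H1 := h (some 1)
    have H2 := h (some 2)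
    simp only [hf0, hf1, hf2] at H0 H1 H2
    match e with
    | none =>
      have H0 := H0 (by simp)
      have H2 := H2 (by simp)
      simp only [intercept, Option.elim_none] at H0 H2
      exact h12 (H0.trans H2.symm)
    | some s =>
      simp only [intercept, Option.elim_some, ne_eq, Option.some.injEq] at H0 H1 H2
      by_cases hs0 : s = 0
      · subst hs0
        exact h3 (by linear_combination H2 h2 - H1 one_ne_zero)
      · by_cases hs1 : s = 1
        · subst hs1
          exact h3 (by linear_combination H2 h12.symm - H0 zero_ne_one)
        · exact one_ne_zero (α := K) (by linear_combination H1 (Ne.symm hs1) - H0 (Ne.symm hs0))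

lemma exists_markings (h2 : (2 : K) ≠ 0) (h3 : (3 : K) ≠ 0) :
    ∃ S : Finset (Option K → K × K), (∀ f ∈ S, IsMarking f) ∧
      S.card = (Fintype.card K - 1) ^ (Fintype.card K - 2) := by
  have h12 : (1 : K) ≠ 2 := fun h => one_ne_zero (α := K) (by linear_combination -h)
  refine ⟨univ.image fun m d => pointAt d (scaleOf m d), ?_, ?_⟩
  · simp only [Finset.mem_image, Finset.mem_univ, true_and]
    rintro _ ⟨m, rfl⟩
    exact isMarking_pointAt_scaleOf h2 h3 m
  · have hinj : Function.Injective fun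
        (m : {d : Option K // d ∉ ({some 0, some 1, some 2} : Finset (Option K))} → Kˣ) d =>
          pointAt d (scaleOf m d) := by
      intro m m' h
      funext ⟨d, hd⟩
      have := pointAt_injective d (congrFun h d)
      rw [scaleOf, scaleOf, dif_pos hd, dif_pos hd] at this
      exact Units.ext this
    rw [Finset.card_image_of_injective _ hinj, Finset.card_univ, Fintype.card_fun,
      Fintype.card_units]
    congr 1
    rw [Fintype.card_subtype_compl, Fintype.card_option, Fintype.card_coe, Finset.card_eq_three.mpr
      ⟨some 0, some 1, some 2, by simp, by simpa using h2.symm, by simpa using h12, rfl⟩]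
    omega

lemma exists_inequivalent_markings (h2 : (2 : K) ≠ 0) (h3 : (3 : K) ≠ 0)
    (θ : Option (Option K) × (Option K ⊕ ℕ) ≃ ℕ) :
    ∃ (n : ℕ) (f : Fin n → Option K → K × K),
      (Fintype.card K - 1) ^ (Fintype.card K - 2) ≤
        (Fintype.card K + 1).factorial * Fintype.card K ^ 2 * n ∧
      (∀ k, IsMarking (f k)) ∧ ∀ k l, k ≠ l →
        ¬ (EmbedsIn (hypergraph θ (f k)) (hypergraph θ (f l)) ∧
          EmbedsIn (hypergraph θ (f l)) (hypergraph θ (f k))) := by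
  obtain ⟨S, hS, hcard⟩ := exists_markings h2 h3
  let s : Setoid (Option K → K × K) :=
    ⟨fun f g => EmbedsIn (hypergraph θ f) (hypergraph θ g) ∧
      EmbedsIn (hypergraph θ g) (hypergraph θ f), fun _ => ⟨.refl _, .refl _⟩, And.symm,
      fun h h' => ⟨h.1.trans h'.1, h'.2.trans h.2⟩⟩
  obtain ⟨n, f, hn, hfS, hf⟩ := exists_inequivalent s S _ fun f hf T hT hfT =>
    card_embedsIn_le (hS f hf) θ T fun g hg => ⟨hS g (hT hg), (hfT g hg).1⟩
  exact ⟨n, f, hcard ▸ hn, fun k => hS _ (hfS k), hf⟩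
end Hypergraph

lemma log_add_sqrt_le {m : ℕ} (hm : 2000 ≤ m) :
    √(2 * m + 3) + 2 + 5 * Real.log (2 * m + 2) ≤ (m + 1) * Real.log 2 := by
  have hm' : (2000 : ℝ) ≤ m := by exact_mod_cast hm
  have hs := Real.sq_sqrt (show (0 : ℝ) ≤ 2 * m + 3 by linarith)
  have hs60 : 60 ≤ √(2 * (m : ℝ) + 3) := Real.le_sqrt_of_sq_le (by linarith)
  have hlog : Real.log (2 * m + 2) ≤ 2 * √(2 * m + 3) := by
    have h1 : Real.log (2 * m + 2) ≤ Real.log (2 * m + 3) :=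
      Real.log_le_log (by linarith) (by linarith)
    have h2 := Real.log_le_sub_one_of_pos (show 0 < √(2 * (m : ℝ) + 3) by linarith)
    rw [Real.log_sqrt (by linarith)] at h2
    linarith
  have hlog2 := Real.log_two_gt_d9
  nlinarith

lemma factorial_le_two_mul_pow (m : ℕ) (hm : 2000 ≤ m) :
    Real.exp √(2 * m + 3) * ((2 * m + 2).factorial * (2 * m + 1) ^ 2) ≤
      (2 * m : ℝ) ^ (2 * m - 1) := by
  have hm0 : (0 : ℝ) < m := by exact_mod_cast (by omega : 0 < m)
  have hfact : ((2 * m + 2).factorial : ℝ) * 2 ^ (m + 1) ≤ (2 * m + 2) ^ (2 * m + 2) := by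
    have h1 := Nat.factorial_two_mul_le (m + 1)
    have h2 := Nat.factorial_le_pow (m + 1)
    have h3 : (2 * (m + 1)).factorial * 2 ^ (m + 1) ≤ (2 * m + 2) ^ (2 * m + 2) := by
      calc _ ≤ (2 * (m + 1)) ^ (m + 1) * (m + 1) ^ (m + 1) * 2 ^ (m + 1) := by
            gcongr
            exact h1.trans (by gcongr)
        _ = (2 * m + 2) ^ (2 * m + 2) := by
          rw [mul_assoc, ← mul_pow, ← mul_pow, show 2 * m + 2 = 2 * (m + 1) by ring, pow_mul]
          ring
    exact_mod_cast h3
  have hratio : ((2 * m + 2 : ℝ)) ^ (2 * m - 1) ≤ Real.exp 2 * (2 * m) ^ (2 * m - 1) := by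
    have h1 : (2 * m + 2 : ℝ) = (1 + 1 / m) * (2 * m) := by field_simp
    rw [h1, mul_pow]
    gcongr
    calc (1 + 1 / m : ℝ) ^ (2 * m - 1) ≤ (1 + 1 / m : ℝ) ^ (2 * m) :=
          pow_le_pow_right₀ (by simp) (Nat.sub_le _ _)
      _ ≤ Real.exp (1 / m) ^ (2 * m) := by
          gcongr
          rw [add_comm]
          exact Real.add_one_le_exp _
      _ = Real.exp 2 := by
          rw [← Real.exp_nat_mul]
          congr 1
          push_cast
          field_simp
  have hexp : Real.exp √(2 * m + 3) * Real.exp 2 * (2 * m + 2) ^ 5 ≤ 2 ^ (m + 1) := by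
    rw [← Real.exp_log (show (0 : ℝ) < 2 * m + 2 by positivity),
      ← Real.exp_log (show (0 : ℝ) < 2 by norm_num), ← Real.exp_nat_mul, ← Real.exp_nat_mul,
      ← Real.exp_add, ← Real.exp_add, Real.exp_le_exp]
    have := log_add_sqrt_le hm
    rw [Real.exp_log (show (0 : ℝ) < 2 by norm_num)]
    push_cast
    linarith
  refine le_of_mul_le_mul_right ?_ (show (0 : ℝ) < 2 ^ (m + 1) by positivity)
  calc _ = Real.exp √(2 * m + 3) * (((2 * m + 2).factorial * 2 ^ (m + 1)) * (2 * m + 1) ^ 2) := by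
        ring
    _ ≤ Real.exp √(2 * m + 3) * ((2 * m + 2) ^ (2 * m + 2) * (2 * m + 2) ^ 2) := by
        gcongr
        norm_num
    _ = Real.exp √(2 * m + 3) * (2 * m + 2) ^ 5 * (2 * m + 2) ^ (2 * m - 1) := by
        obtain ⟨n, rfl⟩ : ∃ n, m = n + 1 := ⟨m - 1, by omega⟩
        rw [show 2 * (n + 1) + 2 = 2 * (n + 1) - 1 + 3 by omega, pow_add]
        ring
    _ ≤ Real.exp √(2 * m + 3) * (2 * m + 2) ^ 5 * (Real.exp 2 * (2 * m) ^ (2 * m - 1)) := by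
        gcongr
    _ = (2 * m) ^ (2 * m - 1) * (Real.exp √(2 * m + 3) * Real.exp 2 * (2 * m + 2) ^ 5) := by ring
    _ ≤ _ := by gcongr

theorem statement_9 (δ : ℝ) (hδ0 : 0 < δ) (hδ : δ < 1 / 2) (N : ℕ) :
    ∃ r : ℕ, N ≤ r ∧
      ∃ (n : ℕ) (Hs : Fin n → Set (Finset ℕ)),
        Real.exp ((r : ℝ) ^ ((1 : ℝ) / 2 - δ)) ≤ (n : ℝ) ∧
        (∀ k : Fin n,
          (∃ sides : Fin r → Set ℕ, Partite (Hs k) sides) ∧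
          Uniform (Hs k) r ∧ Intersecting (Hs k) ∧ coverNumber (Hs k) = r - 1 ∧
          (∀ G : Set (Finset ℕ),
            (∃ sides : Fin r → Set ℕ, Partite G sides) → Uniform G r →
            Intersecting G → coverNumber G = r - 1 →
            EmbedsIn (Hs k) G → EmbedsIn G (Hs k))) ∧
        ∀ k l : Fin n, k ≠ l → ¬ (EmbedsIn (Hs k) (Hs l) ∧ EmbedsIn (Hs l) (Hs k)) := by
  obtain ⟨p, hpN, hp⟩ := Nat.exists_infinite_primes (N + 4001)
  have : Fact p.Prime := ⟨hp⟩
  obtain ⟨m, rfl⟩ := hp.odd_of_ne_two (by omega)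
  have hcard : Fintype.card (ZMod (2 * m + 1)) = 2 * m + 1 := ZMod.card _
  have hcast : ∀ a : ℕ, 0 < a → a < 2 * m + 1 → (a : ZMod (2 * m + 1)) ≠ 0 := fun a ha ha' h =>
    absurd (Nat.le_of_dvd ha ((ZMod.natCast_eq_zero_iff _ _).mp h)) (by omega)
  obtain ⟨θ⟩ : Nonempty
      (Option (Option (ZMod (2 * m + 1))) × (Option (ZMod (2 * m + 1)) ⊕ ℕ) ≃ ℕ) :=
    nonempty_equiv_of_countable
  obtain ⟨n, f, hn, hf, hne⟩ := exists_inequivalent_markings (K := ZMod (2 * m + 1))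
    (by exact_mod_cast hcast 2 (by omega) (by omega))
    (by exact_mod_cast hcast 3 (by omega) (by omega)) θ
  have hr : Fintype.card (Option (Option (ZMod (2 * m + 1)))) = 2 * m + 3 := by
    rw [Fintype.card_option, Fintype.card_option, hcard]
  have hK : 3 ≤ Fintype.card (ZMod (2 * m + 1)) := by omega
  let ι := Fintype.equivFinOfCardEq hr
  refine ⟨2 * m + 3, by omega, n, fun k => hypergraph θ (f k), ?_, fun k =>
    ⟨⟨_, partite_hypergraph θ (f k) ι⟩, uniform_hypergraph θ (f k) ι,
      intersecting_hypergraph θ (hf k), ?_, ?_⟩, hne⟩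
  · rw [hcard] at hn
    have hn' : (2 * m : ℝ) ^ (2 * m - 1) ≤ (2 * m + 2).factorial * (2 * m + 1) ^ 2 * n := by
      exact_mod_cast hn
    have hpow : ((2 * m + 3 : ℕ) : ℝ) ^ ((1 : ℝ) / 2 - δ) ≤ √(2 * m + 3) := by
      rw [Real.sqrt_eq_rpow]
      push_cast
      exact Real.rpow_le_rpow_of_exponent_le (by linarith [Nat.cast_nonneg (α := ℝ) m])
        (by linarith)
    refine (Real.exp_le_exp.mpr hpow).trans ?_
    refine le_of_mul_le_mul_right ((factorial_le_two_mul_pow m (by omega)).trans ?_)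
      (show (0 : ℝ) < (2 * m + 2).factorial * (2 * m + 1) ^ 2 by positivity)
    linarith
  · rw [coverNumber_hypergraph θ (hf k) hK, hcard]
    rfl
  · rintro G ⟨sides, hG⟩ hU hI - hemb
    exact embedsIn_hypergraph (hf k) hK hr θ hG hU hI hemb
end
end
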